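/- Let e_1 = q(1) be the rank one detecting subalgebra of type e. Then the group of endotrivial modules T(e_1) is isomorphic to Z/2Z; explicitly, the only indecomposable endotrivial e_1-supermodules are k_ev and k_od, and Ω^n(k_ev) = k_ev for n even and k_od for n odd. -/

import Mathlib

/-!
A concrete model of the supermodule categories of the paper "On Endotrivial
Modules for Lie Superalgebras" attached to the detecting subalgebras
`e_r = q(1)^{×r}`, `f_n = sl(1|1)^{×n}`, to rank-one subalgebras `⟨z⟩` of
`sl(1|1)`, and to the exterior superalgebras `V(a_r) = Λ((a_r)₁)`.

A `GSupMod k ι` is a finite-dimensional `ℤ₂`-graded `k`-vector space together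
with a family of odd operators `θ i` (the actions of the distinguished odd
basis elements of the superalgebra: the `e_i` for `e_r`, the `x_i, y_i` for
`f_n`, the `a_i` for `V(a_r)`).  The even parts of all these superalgebras are
generated by the brackets of the odd generators, so the relations defining
each particular category, as well as complete reducibility over the even part,
are imposed by a predicate `𝒞 : GSupMod k ι → Prop`, defined separately for
each case.  All categorical notions (homomorphisms, isomorphisms, direct sums,
tensor products, duals, internal Hom, trivial modules, projectivity,
projective covers and injective hulls, syzygies `Ωⁿ` for `n : ℤ`, endotrivial
modules, and the group `T` of stable classes of endotrivial modules) are
defined relative to such a predicate.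
-/

noncomputable section

namespace SupCat

open Submodule

/-- A finite-dimensional `ℤ₂`-graded `k`-vector space with a family of odd
operators `θ i`, indexed by `ι` (the underlying data of a supermodule over a
superalgebra whose odd part has a distinguished basis indexed by `ι`). -/
structure GSupMod (k : Type) [Field k] (ι : Type) : Type 1 where
  carrier : Type
  [isAddCommGroup : AddCommGroup carrier]
  [isModule : Module k carrier]
  [isFinite : FiniteDimensional k carrier]
  /-- the even component -/
  ev : Submodule k carrier
  /-- the odd component -/
  od : Submodule k carrier
  isCompl : IsCompl ev od
  /-- the (odd) actions of the distinguished odd basis elements -/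
  θ : ι → (carrier →ₗ[k] carrier)
  θ_ev : ∀ i, ∀ m ∈ ev, θ i m ∈ od
  θ_od : ∀ i, ∀ m ∈ od, θ i m ∈ ev

attribute [instance] GSupMod.isAddCommGroup GSupMod.isModule GSupMod.isFinite

namespace GSupMod

variable {k : Type} [Field k] {ι : Type}

/-- The action of a general odd element `v = ∑ v i • (basis element i)`. -/
def actOf [Fintype ι] (M : GSupMod k ι) (v : ι → k) : M.carrier →ₗ[k] M.carrier :=
  ∑ i, v i • M.θ i

/-- The grading involution `σ` of a supermodule: `+1` on the even part and
`-1` on the odd part. -/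
def sigma (M : GSupMod k ι) : M.carrier →ₗ[k] M.carrier :=
  M.ev.subtype ∘ₗ Submodule.linearProjOfIsCompl M.ev M.od M.isCompl
    - M.od.subtype ∘ₗ Submodule.linearProjOfIsCompl M.od M.ev M.isCompl.symm

/-- `f` is a homomorphism of supermodules (an equivariant linear map of
degree `0̄`). -/
def IsHom (M N : GSupMod k ι) (f : M.carrier →ₗ[k] N.carrier) : Prop :=
  (∀ i, f ∘ₗ M.θ i = N.θ i ∘ₗ f) ∧
  (∀ m ∈ M.ev, f m ∈ N.ev) ∧ (∀ m ∈ M.od, f m ∈ N.od)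

/-- `M ≅ N` as supermodules. -/
def Iso (M N : GSupMod k ι) : Prop :=
  ∃ e : M.carrier ≃ₗ[k] N.carrier, IsHom M N (e : M.carrier →ₗ[k] N.carrier)

/-- `S` is (isomorphic to) the direct sum `A ⊕ B`. -/
def IsDsum (A B S : GSupMod k ι) : Prop :=
  ∃ φ : S.carrier ≃ₗ[k] A.carrier × B.carrier,
    (∀ s, s ∈ S.ev ↔ (φ s).1 ∈ A.ev ∧ (φ s).2 ∈ B.ev) ∧
    (∀ s, s ∈ S.od ↔ (φ s).1 ∈ A.od ∧ (φ s).2 ∈ B.od) ∧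
    ∀ (i : ι) (s : S.carrier),
      φ (S.θ i s) = LinearMap.prodMap (A.θ i) (B.θ i) (φ s)

/-- `M` is (isomorphic to) the trivial supermodule of parity `p`: `k_ev`
for `p = false`, and `k_od = Π(k_ev)` for `p = true`. -/
def IsTrivial (p : Bool) (M : GSupMod k ι) : Prop :=
  Module.finrank k M.carrier = 1 ∧ (∀ i, M.θ i = 0) ∧
    (if p then M.od = ⊤ else M.ev = ⊤)

/-- `M` is indecomposable. -/
def Indecomposable (M : GSupMod k ι) : Prop :=
  (∃ m : M.carrier, m ≠ 0) ∧
  ∀ A B : GSupMod k ι, IsDsum A B M →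
    (∀ a : A.carrier, a = 0) ∨ (∀ b : B.carrier, b = 0)

/-- `M` is a simple supermodule: nonzero, with no proper nonzero graded
invariant submodule. -/
def IsSimple (M : GSupMod k ι) : Prop :=
  (∃ m : M.carrier, m ≠ 0) ∧
  ∀ N : Submodule k M.carrier,
    (∀ i, ∀ m ∈ N, M.θ i m ∈ N) →
    N = (N ⊓ M.ev) ⊔ (N ⊓ M.od) →
    N = ⊥ ∨ N = ⊤

variable (𝒞 : GSupMod k ι → Prop)

/-- `P` is a projective object of the category cut out by `𝒞` (defined by the
lifting property). -/
def IsProjective (P : GSupMod k ι) : Prop :=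
  𝒞 P ∧
  ∀ (M N : GSupMod k ι) (π : M.carrier →ₗ[k] N.carrier)
    (f : P.carrier →ₗ[k] N.carrier),
    𝒞 M → 𝒞 N → IsHom M N π → Function.Surjective π → IsHom P N f →
    ∃ h : P.carrier →ₗ[k] M.carrier, IsHom P M h ∧ π ∘ₗ h = f

/-- `I` is an injective object of the category cut out by `𝒞`. -/
def IsInjective (I : GSupMod k ι) : Prop :=
  𝒞 I ∧
  ∀ (M N : GSupMod k ι) (j : M.carrier →ₗ[k] N.carrier)
    (f : M.carrier →ₗ[k] I.carrier),
    𝒞 M → 𝒞 N → IsHom M N j → Function.Injective j → IsHom M I f →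
    ∃ h : N.carrier →ₗ[k] I.carrier, IsHom N I h ∧ h ∘ₗ j = f

/-- `π : P ↠ M` is a projective cover. -/
def IsProjCover (P M : GSupMod k ι) (π : P.carrier →ₗ[k] M.carrier) : Prop :=
  IsProjective 𝒞 P ∧ IsHom P M π ∧ Function.Surjective π ∧
  ∀ (Q : GSupMod k ι) (f : Q.carrier →ₗ[k] P.carrier),
    𝒞 Q → IsHom Q P f → Function.Surjective (π ∘ₗ f) → Function.Surjective f

/-- `j : M ↪ I` is an injective hull. -/
def IsInjHull (M I : GSupMod k ι) (j : M.carrier →ₗ[k] I.carrier) : Prop :=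
  IsInjective 𝒞 I ∧ IsHom M I j ∧ Function.Injective j ∧
  ∀ (Q : GSupMod k ι) (f : I.carrier →ₗ[k] Q.carrier),
    𝒞 Q → IsHom I Q f → Function.Injective (f ∘ₗ j) → Function.Injective f

/-- `N` is (isomorphic to) the first syzygy `Ω¹(M)`, the kernel of a
projective cover of `M`. -/
def IsSyzygy (M N : GSupMod k ι) : Prop :=
  𝒞 N ∧
  ∃ (P : GSupMod k ι) (π : P.carrier →ₗ[k] M.carrier)
    (i : N.carrier →ₗ[k] P.carrier),
    IsProjCover 𝒞 P M π ∧ IsHom N P i ∧ Function.Injective i ∧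
    LinearMap.range i = LinearMap.ker π

/-- `N` is (isomorphic to) the first cosyzygy `Ω⁻¹(M)`, the cokernel of the
inclusion of `M` into its injective hull. -/
def IsCosyzygy (M N : GSupMod k ι) : Prop :=
  𝒞 N ∧
  ∃ (I : GSupMod k ι) (j : M.carrier →ₗ[k] I.carrier)
    (p : I.carrier →ₗ[k] N.carrier),
    IsInjHull 𝒞 M I j ∧ IsHom I N p ∧ Function.Surjective p ∧
    LinearMap.ker p = LinearMap.range j

/-- `M` has no nonzero projective direct summand (equivalently, since the
category is self-injective, no nonzero projective submodule). -/
def NoProjSummands (M : GSupMod k ι) : Prop :=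
  ∀ A B : GSupMod k ι, IsProjective 𝒞 A → IsDsum A B M → ∀ a : A.carrier, a = 0

/-- `N` is (isomorphic to) `Ω⁰(M)`, the complement of the largest projective
direct summand of `M`. -/
def IsOmegaZero (M N : GSupMod k ι) : Prop :=
  ∃ Q : GSupMod k ι, IsProjective 𝒞 Q ∧ NoProjSummands 𝒞 N ∧ IsDsum N Q M

/-- `N` is (isomorphic to) `Ωⁿ(M)` for `n ∈ ℕ`. -/
def IsOmegaPow : ℕ → GSupMod k ι → GSupMod k ι → Prop
  | 0, M, N => IsOmegaZero 𝒞 M N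
  | n+1, M, N => ∃ L, IsOmegaPow n M L ∧ IsSyzygy 𝒞 L N

/-- `N` is (isomorphic to) `Ω⁻ⁿ(M)` for `n ∈ ℕ`. -/
def IsOmegaNegPow : ℕ → GSupMod k ι → GSupMod k ι → Prop
  | 0, M, N => IsOmegaZero 𝒞 M N
  | n+1, M, N => ∃ L, IsOmegaNegPow n M L ∧ IsCosyzygy 𝒞 L N

/-- `N` is (isomorphic to) the syzygy `Ωⁿ(M)`, for any `n : ℤ`. -/
def IsOmega (n : ℤ) (M N : GSupMod k ι) : Prop :=
  if 0 ≤ n then IsOmegaPow 𝒞 n.toNat M N else IsOmegaNegPow 𝒞 (-n).toNat M N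

/-- `H` is (isomorphic to) the internal Hom supermodule `Hom_k(M,N)` with its
usual grading and the super action of the odd generators
`(θ i · f)(m) = θ i (f m) - (-1)^{|f|} f (θ i m)` (the sign `(-1)^{|f|}` is
expressed via the grading involutions `σ`). -/
def IsHomObj (M N H : GSupMod k ι) : Prop :=
  ∃ φ : H.carrier ≃ₗ[k] (M.carrier →ₗ[k] N.carrier),
    (∀ h, h ∈ H.ev ↔ ((∀ m ∈ M.ev, φ h m ∈ N.ev) ∧ (∀ m ∈ M.od, φ h m ∈ N.od))) ∧
    (∀ h, h ∈ H.od ↔ ((∀ m ∈ M.ev, φ h m ∈ N.od) ∧ (∀ m ∈ M.od, φ h m ∈ N.ev))) ∧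
    ∀ (i : ι) (h : H.carrier),
      φ (H.θ i h) = N.θ i ∘ₗ φ h - (N.sigma ∘ₗ φ h ∘ₗ M.sigma) ∘ₗ M.θ i

/-- `T` is (isomorphic to) the tensor product supermodule `M ⊗_k N` with its
usual grading and the action of the odd generators
`θ i · (m ⊗ n) = (θ i m) ⊗ n + (-1)^{|m|} m ⊗ (θ i n)`. -/
def IsTensorObj (M N T : GSupMod k ι) : Prop :=
  ∃ φ : T.carrier ≃ₗ[k] TensorProduct k M.carrier N.carrier,
    Submodule.map (φ : T.carrier →ₗ[k] TensorProduct k M.carrier N.carrier) T.ev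
      = Submodule.span k
          ({z | ∃ m ∈ M.ev, ∃ n ∈ N.ev, z = m ⊗ₜ[k] n}
            ∪ {z | ∃ m ∈ M.od, ∃ n ∈ N.od, z = m ⊗ₜ[k] n}) ∧
    Submodule.map (φ : T.carrier →ₗ[k] TensorProduct k M.carrier N.carrier) T.od
      = Submodule.span k
          ({z | ∃ m ∈ M.ev, ∃ n ∈ N.od, z = m ⊗ₜ[k] n}
            ∪ {z | ∃ m ∈ M.od, ∃ n ∈ N.ev, z = m ⊗ₜ[k] n}) ∧
    ∀ (i : ι) (t : T.carrier),
      φ (T.θ i t)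
        = TensorProduct.map (M.θ i) (LinearMap.id : N.carrier →ₗ[k] N.carrier) (φ t)
            + TensorProduct.map M.sigma (N.θ i) (φ t)

/-- `D` is (isomorphic to) the dual supermodule `M* = Hom_k(M, k_ev)`, with
the action `(θ i · ψ)(m) = -(-1)^{|ψ|} ψ (θ i m)`. -/
def IsDualObj (M D : GSupMod k ι) : Prop :=
  ∃ φ : D.carrier ≃ₗ[k] Module.Dual k M.carrier,
    (∀ d, d ∈ D.ev ↔ ∀ m ∈ M.od, φ d m = 0) ∧
    (∀ d, d ∈ D.od ↔ ∀ m ∈ M.ev, φ d m = 0) ∧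
    ∀ (i : ι) (d : D.carrier),
      φ (D.θ i d) = - (φ d) ∘ₗ (M.sigma ∘ₗ M.θ i)

/-- `M` is an endotrivial supermodule of the category cut out by `𝒞`:
`Hom_k(M,M) ≅ k_ev ⊕ P` with `P` projective. -/
def IsEndotrivial (M : GSupMod k ι) : Prop :=
  𝒞 M ∧
  ∃ H K P S : GSupMod k ι, IsHomObj M M H ∧ 𝒞 H ∧ IsTrivial false K ∧
    IsProjective 𝒞 P ∧ IsDsum K P S ∧ Iso H S

/-- `M` and `N` are isomorphic in the stable module category: they become
isomorphic after adding projective direct summands. -/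
def StIso (M N : GSupMod k ι) : Prop :=
  ∃ P Q S T : GSupMod k ι, IsProjective 𝒞 P ∧ IsProjective 𝒞 Q ∧
    IsDsum M P S ∧ IsDsum N Q T ∧ Iso S T

/-- `R` is (isomorphic to) the restriction of `M` along the subalgebra of the
odd space spanned by the vectors `ε j`: the same underlying graded vector
space, where the `j`-th odd generator acts as the element `ε j` did on `M`. -/
def IsRestriction {ι' : Type} [Fintype ι] (ε : ι' → ι → k)
    (M : GSupMod k ι) (R : GSupMod k ι') : Prop :=
  ∃ φ : R.carrier ≃ₗ[k] M.carrier,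
    (∀ m, m ∈ R.ev ↔ φ m ∈ M.ev) ∧
    (∀ m, m ∈ R.od ↔ φ m ∈ M.od) ∧
    ∀ (j : ι') (m : R.carrier), φ (R.θ j m) = actOf M (ε j) (φ m)

/-- The radical `Rad(M)` of a supermodule over one of the detecting
superalgebras on the principal block: the span of the images of the odd
generators. -/
def radical (M : GSupMod k ι) : Submodule k M.carrier :=
  ⨆ i, LinearMap.range (M.θ i)

/-- The rank `Rk(M) = dim_k (M / Rad M)`. -/
def rk (M : GSupMod k ι) : ℕ :=
  Module.finrank k (M.carrier ⧸ radical M)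

end GSupMod

open GSupMod

variable {k : Type} [Field k]

/-- The category of supermodules (in the principal block) over the exterior
superalgebra `V(a_r) = Λ((a_r)₁)` on the purely odd abelian `r`-dimensional
space `(a_r)₁`: the odd generators pairwise super-anticommute (in particular
they square to zero).  Complete reducibility over the even part is automatic
since the even part acts by zero. -/
def VCat (k : Type) [Field k] (r : ℕ) : GSupMod k (Fin r) → Prop :=
  fun M => ∀ i j, M.θ i ∘ₗ M.θ j + M.θ j ∘ₗ M.θ i = 0

/-- The relation on endotrivial supermodules inducing the group `T`: stable
isomorphism. -/
def TRel {ι : Type} (𝒞 : GSupMod k ι → Prop) :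
    {M : GSupMod k ι // IsEndotrivial 𝒞 M} →
    {M : GSupMod k ι // IsEndotrivial 𝒞 M} → Prop :=
  fun M N => StIso 𝒞 M.1 N.1

/-- The underlying set of the group `T`: stable isomorphism classes of
endotrivial supermodules. -/
def TGrp {ι : Type} (𝒞 : GSupMod k ι → Prop) : Type 1 := Quot (TRel 𝒞)

/-- The stable class of an endotrivial supermodule. -/
def tmk {ι : Type} (𝒞 : GSupMod k ι → Prop)
    (M : {M : GSupMod k ι // IsEndotrivial 𝒞 M}) : TGrp 𝒞 :=
  Quot.mk (TRel 𝒞) M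

/-- An abelian group structure on `T` whose multiplication, identity and
inverse are induced by tensor product, the trivial module `k_ev` and duality
respectively. -/
structure TGroupData {ι : Type} (𝒞 : GSupMod k ι → Prop) : Type 1 where
  mul : TGrp 𝒞 → TGrp 𝒞 → TGrp 𝒞
  one : TGrp 𝒞
  inv : TGrp 𝒞 → TGrp 𝒞
  mul_assoc : ∀ a b c, mul (mul a b) c = mul a (mul b c)
  mul_comm : ∀ a b, mul a b = mul b a
  one_mul : ∀ a, mul one a = a
  inv_mul : ∀ a, mul (inv a) a = one
  mul_spec : ∀ (M N : {M : GSupMod k ι // IsEndotrivial 𝒞 M}) (T : GSupMod k ι)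
      (_ : IsTensorObj M.1 N.1 T) (hT : IsEndotrivial 𝒞 T),
      mul (tmk 𝒞 M) (tmk 𝒞 N) = tmk 𝒞 ⟨T, hT⟩
  one_spec : ∀ (K : GSupMod k ι) (_ : IsTrivial false K) (hK : IsEndotrivial 𝒞 K),
      one = tmk 𝒞 ⟨K, hK⟩
  inv_spec : ∀ (M : {M : GSupMod k ι // IsEndotrivial 𝒞 M}) (D : GSupMod k ι)
      (_ : IsDualObj M.1 D) (hD : IsEndotrivial 𝒞 D),
      inv (tmk 𝒞 M) = tmk 𝒞 ⟨D, hD⟩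

end SupCat

namespace SupCat

variable {k : Type} [Field k]

/-- The category `F(q(1)) = F_(q(1), q(1)₀)` of finite-dimensional
`q(1)`-supermodules which are completely reducible over the even part
`q(1)₀ = ⟨t⟩`.  Since `[e,e] = 2t`, a `q(1)`-supermodule is a graded space
with one odd operator `e` (the even generator `t` acting as `e ∘ e`), and
complete reducibility over `⟨t⟩` says that every `t`-invariant submodule has
a `t`-invariant complement. -/
def QCat (k : Type) [Field k] : GSupMod k (Fin 1) → Prop := fun M =>
  ∀ N : Submodule k M.carrier, (∀ m ∈ N, M.θ 0 (M.θ 0 m) ∈ N) →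
    ∃ N' : Submodule k M.carrier,
      (∀ m ∈ N', M.θ 0 (M.θ 0 m) ∈ N') ∧ IsCompl N N'

end SupCat

namespace SupCat

section helpers

set_option linter.unusedSectionVars false

variable {k : Type} [Field k]

theorem sigma_of_ev {ι : Type} (M : GSupMod k ι) {x : M.carrier} (hx : x ∈ M.ev) :
    M.sigma x = x := by
  have h1 := Submodule.projectionOnto_apply_left M.isCompl ⟨x, hx⟩
  have h2 := Submodule.projectionOnto_apply_right M.isCompl.symm ⟨x, hx⟩
  simp only [GSupMod.sigma, LinearMap.sub_apply, LinearMap.comp_apply]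
  simp only at h1 h2
  erw [h1, h2]
  simp

theorem sigma_of_od {ι : Type} (M : GSupMod k ι) {x : M.carrier} (hx : x ∈ M.od) :
    M.sigma x = -x := by
  have h1 := Submodule.projectionOnto_apply_left M.isCompl.symm ⟨x, hx⟩
  have h2 := Submodule.projectionOnto_apply_right M.isCompl ⟨x, hx⟩
  simp only [GSupMod.sigma, LinearMap.sub_apply, LinearMap.comp_apply]
  simp only at h1 h2
  erw [h1, h2]
  simp

/-- two linear maps agreeing on the even and odd parts are equal -/
theorem lin_ext {ι : Type} (M : GSupMod k ι) {V : Type} [AddCommGroup V] [Module k V]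
    {f g : M.carrier →ₗ[k] V} (h0 : ∀ x ∈ M.ev, f x = g x) (h1 : ∀ x ∈ M.od, f x = g x) :
    ∀ x, f x = g x := by
  intro x
  have hx : x ∈ M.ev ⊔ M.od := by rw [M.isCompl.sup_eq_top]; trivial
  obtain ⟨a, ha, b, hb, rfl⟩ := Submodule.mem_sup.1 hx
  rw [map_add, map_add, h0 a ha, h1 b hb]

theorem sigma_sigma {ι : Type} (M : GSupMod k ι) (x : M.carrier) : M.sigma (M.sigma x) = x := by
  refine lin_ext M (f := M.sigma ∘ₗ M.sigma) (g := LinearMap.id) ?_ ?_ x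
  · intro x hx; simp [sigma_of_ev M hx]
  · intro x hx; simp [sigma_of_od M hx]

theorem sigma_theta {ι : Type} (M : GSupMod k ι) (i : ι) (x : M.carrier) :
    M.sigma (M.θ i x) = - M.θ i (M.sigma x) := by
  refine lin_ext M (f := M.sigma ∘ₗ M.θ i) (g := - (M.θ i ∘ₗ M.sigma)) ?_ ?_ x
  · intro x hx; simp [sigma_of_ev M hx, sigma_of_od M (M.θ_ev i x hx)]
  · intro x hx; simp [sigma_of_od M hx, sigma_of_ev M (M.θ_od i x hx)]

variable [CharZero k]

theorem eq_zero_of_eq_neg {V : Type} [AddCommGroup V] [Module k V] {x : V} (h : x = -x) :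
    x = 0 := by
  have h2 : (2 : k) • x = 0 := by
    rw [two_smul]; nth_rewrite 1 [h]; simp
  exact (smul_eq_zero.1 h2).resolve_left two_ne_zero

theorem mem_ev_iff {ι : Type} (M : GSupMod k ι) {x : M.carrier} : x ∈ M.ev ↔ M.sigma x = x := by
  refine ⟨sigma_of_ev M, fun h => ?_⟩
  have hx : x ∈ M.ev ⊔ M.od := by rw [M.isCompl.sup_eq_top]; trivial
  obtain ⟨a, ha, b, hb, rfl⟩ := Submodule.mem_sup.1 hx
  rw [map_add, sigma_of_ev M ha, sigma_of_od M hb] at h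
  have : b = 0 := eq_zero_of_eq_neg (k := k) (add_left_cancel h).symm
  simpa [this] using ha

theorem mem_od_iff {ι : Type} (M : GSupMod k ι) {x : M.carrier} :
    x ∈ M.od ↔ M.sigma x = -x := by
  refine ⟨sigma_of_od M, fun h => ?_⟩
  have hx : x ∈ M.ev ⊔ M.od := by rw [M.isCompl.sup_eq_top]; trivial
  obtain ⟨a, ha, b, hb, rfl⟩ := Submodule.mem_sup.1 hx
  rw [map_add, sigma_of_ev M ha, sigma_of_od M hb, neg_add] at h
  have : a = 0 := eq_zero_of_eq_neg (k := k) (add_right_cancel h)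
  simpa [this] using hb

theorem comm_sigma_iff {ι : Type} (M N : GSupMod k ι) (f : M.carrier →ₗ[k] N.carrier) :
    ((∀ m ∈ M.ev, f m ∈ N.ev) ∧ (∀ m ∈ M.od, f m ∈ N.od)) ↔
      ∀ x, f (M.sigma x) = N.sigma (f x) := by
  constructor
  · rintro ⟨h0, h1⟩ x
    refine lin_ext M (f := f ∘ₗ M.sigma) (g := N.sigma ∘ₗ f) ?_ ?_ x
    · intro x hx; simp [sigma_of_ev M hx, sigma_of_ev N (h0 x hx)]
    · intro x hx; simp [sigma_of_od M hx, sigma_of_od N (h1 x hx)]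
  · intro h
    constructor
    · intro m hm; rw [mem_ev_iff, ← h, sigma_of_ev M hm]
    · intro m hm; rw [mem_od_iff, ← h, sigma_of_od M hm, map_neg]

theorem isHom_iff (M N : GSupMod k (Fin 1)) (f : M.carrier →ₗ[k] N.carrier) :
    GSupMod.IsHom M N f ↔ (∀ x, f (M.θ 0 x) = N.θ 0 (f x)) ∧
      ∀ x, f (M.sigma x) = N.sigma (f x) := by
  unfold GSupMod.IsHom
  rw [comm_sigma_iff]
  refine and_congr_left fun _ => ?_
  rw [Fin.forall_fin_one]
  exact LinearMap.ext_iff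

theorem isDsum_iff (A B S : GSupMod k (Fin 1)) :
    GSupMod.IsDsum A B S ↔ ∃ φ : S.carrier ≃ₗ[k] A.carrier × B.carrier,
      (∀ s, φ (S.sigma s) = (A.sigma (φ s).1, B.sigma (φ s).2)) ∧
      ∀ s, φ (S.θ 0 s) = (A.θ 0 (φ s).1, B.θ 0 (φ s).2) := by
  unfold GSupMod.IsDsum
  refine exists_congr fun φ => ?_
  rw [← and_assoc]
  refine and_congr ?_ (by rw [Fin.forall_fin_one]; rfl)
  constructor
  · rintro ⟨h0, h1⟩ s
    refine lin_ext S (f := φ.toLinearMap ∘ₗ S.sigma)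
      (g := (LinearMap.prodMap A.sigma B.sigma) ∘ₗ φ.toLinearMap) ?_ ?_ s
    · intro x hx
      obtain ⟨ha, hb⟩ := (h0 x).1 hx
      ext <;> simp [sigma_of_ev S hx, sigma_of_ev _ ha, sigma_of_ev _ hb]
    · intro x hx
      obtain ⟨ha, hb⟩ := (h1 x).1 hx
      ext <;> simp [sigma_of_od S hx, sigma_of_od _ ha, sigma_of_od _ hb]
  · intro h
    constructor
    · intro s
      rw [mem_ev_iff, mem_ev_iff, mem_ev_iff, ← φ.injective.eq_iff, h, Prod.ext_iff]
    · intro s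
      rw [mem_od_iff, mem_od_iff, mem_od_iff, ← φ.injective.eq_iff, h, Prod.ext_iff]
      simp

/-- build a supermodule from a grading involution and an odd operator -/
def mkS (V : Type) [AddCommGroup V] [Module k V] [FiniteDimensional k V]
    (s e : V →ₗ[k] V) (hs : ∀ x, s (s x) = x) (he : ∀ x, s (e x) = - e (s x)) :
    GSupMod k (Fin 1) where
  carrier := V
  ev := LinearMap.ker (s - LinearMap.id)
  od := LinearMap.ker (s + LinearMap.id)
  isCompl := by
    constructor
    · rw [Submodule.disjoint_def]
      intro x h0 h1
      simp only [LinearMap.mem_ker, LinearMap.sub_apply, LinearMap.add_apply, LinearMap.id_apply,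
        sub_eq_zero, add_eq_zero_iff_eq_neg] at h0 h1
      exact eq_zero_of_eq_neg (k := k) (h0.symm.trans h1)
    · rw [codisjoint_iff, eq_top_iff]
      intro x _
      rw [Submodule.mem_sup]
      refine ⟨(2⁻¹ : k) • (x + s x), ?_, (2⁻¹ : k) • (x - s x), ?_, ?_⟩
      · simp [hs]; abel
      · simp [hs]
      · rw [← smul_add]
        have : x + s x + (x - s x) = (2 : k) • x := by rw [two_smul]; abel
        rw [this, smul_smul, inv_mul_cancel₀ two_ne_zero, one_smul]
  θ := fun _ => e
  θ_ev := by
    intro _ m hm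
    simp only [LinearMap.mem_ker, LinearMap.sub_apply, LinearMap.add_apply, LinearMap.id_apply,
        sub_eq_zero, add_eq_zero_iff_eq_neg] at hm ⊢
    rw [he, hm]
  θ_od := by
    intro _ m hm
    simp only [LinearMap.mem_ker, LinearMap.sub_apply, LinearMap.add_apply, LinearMap.id_apply,
        sub_eq_zero, add_eq_zero_iff_eq_neg] at hm ⊢
    rw [he, hm]; simp

theorem mkS_theta (V : Type) [AddCommGroup V] [Module k V] [FiniteDimensional k V]
    (s e : V →ₗ[k] V) (hs : ∀ x, s (s x) = x) (he : ∀ x, s (e x) = - e (s x)) (x : V) :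
    (mkS V s e hs he).θ 0 x = e x := rfl

theorem mkS_sigma (V : Type) [AddCommGroup V] [Module k V] [FiniteDimensional k V]
    (s e : V →ₗ[k] V) (hs : ∀ x, s (s x) = x) (he : ∀ x, s (e x) = - e (s x)) (x : V) :
    (mkS V s e hs he).sigma x = s x := by
  refine lin_ext (mkS V s e hs he) (f := (mkS V s e hs he).sigma) (g := s) ?_ ?_ x
  · intro x hx
    rw [sigma_of_ev _ hx]
    have : s x - (show V from x) = 0 := hx
    exact (sub_eq_zero.1 this).symm
  · intro x hx
    rw [sigma_of_od _ hx]
    have : s x + (show V from x) = 0 := hx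
    exact (add_eq_zero_iff_eq_neg.1 this).symm

/-- characterisation of the category by squarefree polynomials -/
theorem qcat_iff (M : GSupMod k (Fin 1)) :
    QCat k M ↔ Module.End.IsSemisimple (M.θ 0 ∘ₗ M.θ 0 : Module.End k M.carrier) := by
  rw [Module.End.isSemisimple_iff]; rfl

theorem qcat_poly {M : GSupMod k (Fin 1)} (h : QCat k M) :
    ∃ m : Polynomial k, Squarefree m ∧
      Polynomial.aeval (M.θ 0 ∘ₗ M.θ 0 : Module.End k M.carrier) m = 0 :=
  ⟨_, ((qcat_iff M).1 h).minpoly_squarefree, minpoly.aeval _ _⟩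

theorem qcat_of_poly {M : GSupMod k (Fin 1)} {m : Polynomial k} (hm : Squarefree m)
    (h : Polynomial.aeval (M.θ 0 ∘ₗ M.θ 0 : Module.End k M.carrier) m = 0) : QCat k M :=
  (qcat_iff M).2 (Module.End.isSemisimple_of_squarefree_aeval_eq_zero hm h)

theorem aeval_intertwine {V W : Type} [AddCommGroup V] [Module k V] [AddCommGroup W] [Module k W]
    (f : V →ₗ[k] W) (s : Module.End k V) (t : Module.End k W) (h : ∀ x, f (s x) = t (f x))
    (m : Polynomial k) (x : V) :
    f (Polynomial.aeval s m x) = Polynomial.aeval t m (f x) := by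
  induction m using Polynomial.induction_on' generalizing x with
  | add p q hp hq => simp [hp, hq]
  | monomial n a =>
    have : ∀ x, f ((s ^ n) x) = (t ^ n) (f x) := by
      induction n with
      | zero => simp
      | succ n ih => intro x; simp [pow_succ, ih, h]
    simp [Polynomial.aeval_monomial, this, Module.algebraMap_end_apply]

/-- submodules stay in the category -/
theorem qcat_of_inj {A B : GSupMod k (Fin 1)} (f : A.carrier →ₗ[k] B.carrier)
    (hf : Function.Injective f) (h : ∀ x, f (A.θ 0 x) = B.θ 0 (f x)) (hB : QCat k B) :
    QCat k A := by
  obtain ⟨m, hm, h0⟩ := qcat_poly hB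
  refine qcat_of_poly hm (LinearMap.ext fun x => hf ?_)
  rw [aeval_intertwine f _ (B.θ 0 ∘ₗ B.θ 0) (by intro x; simp [h]) m x, h0]
  simp

theorem qcat_of_sq_zero {A : GSupMod k (Fin 1)} (h : ∀ x, A.θ 0 (A.θ 0 x) = 0) : QCat k A := by
  refine qcat_of_poly (m := Polynomial.X) Polynomial.irreducible_X.squarefree ?_
  ext x; simp [h]

/-- polynomial pseudo-inverse of the even generator -/
theorem exists_pinv {M : GSupMod k (Fin 1)} (hM : QCat k M) :
    ∃ u : M.carrier →ₗ[k] M.carrier,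
      (∀ x, u (M.θ 0 x) = M.θ 0 (u x)) ∧ (∀ x, u (M.sigma x) = M.sigma (u x)) ∧
      (∀ x, M.θ 0 (M.θ 0 (u (M.θ 0 (M.θ 0 x)))) = M.θ 0 (M.θ 0 x)) := by
  classical
  obtain ⟨m, hm, h0⟩ := qcat_poly hM
  have key : ∃ a c : Polynomial k, Polynomial.X = Polynomial.X ^ 2 * a + m * c := by
    have hd : EuclideanDomain.gcd (Polynomial.X ^ 2) m ∣ (Polynomial.X : Polynomial k) := by
      have h1 := EuclideanDomain.gcd_dvd_left (Polynomial.X ^ 2 : Polynomial k) m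
      have h2 : Squarefree (EuclideanDomain.gcd (Polynomial.X ^ 2 : Polynomial k) m) :=
        hm.squarefree_of_dvd (EuclideanDomain.gcd_dvd_right _ _)
      exact (h2.dvd_pow_iff_dvd two_ne_zero).1 h1
    obtain ⟨d, hd⟩ := hd
    refine ⟨EuclideanDomain.gcdA (Polynomial.X ^ 2) m * d, EuclideanDomain.gcdB (Polynomial.X ^ 2) m * d, ?_⟩
    conv_lhs => rw [hd, EuclideanDomain.gcd_eq_gcd_ab]
    ring
  obtain ⟨a, c, hac⟩ := key
  refine ⟨Polynomial.aeval (M.θ 0 ∘ₗ M.θ 0 : Module.End k M.carrier) a, ?_, ?_, ?_⟩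
  · intro x
    exact (aeval_intertwine (M.θ 0) _ _ (by intro x; rfl) a x).symm
  · intro x
    exact (aeval_intertwine M.sigma _ _ (by intro x; simp [sigma_theta]) a x).symm
  · intro x
    have h := congrArg (fun p => Polynomial.aeval (M.θ 0 ∘ₗ M.θ 0 : Module.End k M.carrier) p x) hac
    simp only [map_add, map_mul, h0, zero_mul, add_zero, Polynomial.aeval_X, pow_two] at h
    simp only [Module.End.mul_apply, LinearMap.comp_apply] at h
    have h3 := aeval_intertwine (M.θ 0 ∘ₗ M.θ 0) (M.θ 0 ∘ₗ M.θ 0) (M.θ 0 ∘ₗ M.θ 0) (fun _ => rfl) a x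
    simp only [LinearMap.comp_apply] at h3
    rw [← h3, ← h]

theorem exists_reg {V : Type} [AddCommGroup V] [Module k V] (f : V →ₗ[k] V) :
    ∃ g : V →ₗ[k] V, ∀ x, f (g (f x)) = f x := by
  obtain ⟨s, hs⟩ := f.rangeRestrict.exists_rightInverse_of_surjective f.range_rangeRestrict
  obtain ⟨p, hp⟩ := (LinearMap.range f).subtype.exists_leftInverse_of_injective
    (Submodule.ker_subtype _)
  refine ⟨s ∘ₗ p, fun x => ?_⟩
  have h1 : p (f x) = f.rangeRestrict x := LinearMap.congr_fun hp (f.rangeRestrict x)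
  have h2 := LinearMap.congr_fun hs (f.rangeRestrict x)
  rw [LinearMap.comp_apply, h1]
  exact congrArg Subtype.val h2

end helpers

end SupCat

namespace SupCat

section alg

variable {k : Type} [Field k] [CharZero k]

theorem alg_nil {R : Type} [Ring R] (f s b : R)
    (hff : f * f = 0) (hsf : s * f = - (f * s)) (hb : f * b * f = f) (hsb : s * b = - (b * s)) :
    ∃ c : R, c = b - f * b * b ∧ s * c = -(c * s) ∧ (c * f + f * c) * f = f ∧
      f * (c * f + f * c) = f ∧
      (c * f + f * c) * (c * f + f * c) = c * f + f * c := by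
  have h1 : f * (b - f * b * b) = f * b := by
    linear_combination (norm := noncomm_ring) (-hff) * b * b
  have h2 : (b - f * b * b) * f * f = 0 := by
    linear_combination (norm := noncomm_ring) (b - f * b * b) * hff
  have h3 : f * (b - f * b * b) * f = f := by rw [h1, hb]
  have h4 : f * (b - f * b * b) * (b - f * b * b) * f = 0 := by
    rw [h1]
    linear_combination (norm := noncomm_ring) (-hb) * b * b * f
  refine ⟨b - f * b * b, rfl, ?_, ?_, ?_, ?_⟩
  · linear_combination (norm := noncomm_ring) hsb - hsf * b * b + f * hsb * b - f * b * hsb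
  · generalize b - f * b * b = c at *
    linear_combination (norm := noncomm_ring) h2 + h3
  · generalize b - f * b * b = c at *
    linear_combination (norm := noncomm_ring) hff * c + h3
  · generalize b - f * b * b = c at *
    linear_combination (norm := noncomm_ring) c * h3 + c * hff * c + h4 + h3 * c

theorem alg_main {R : Type} [Ring R] [Algebra k R] (e s u : R) (hs : s * s = 1)
    (hse : s * e = - (e * s)) (hue : u * e = e * u) (hus : u * s = s * u)
    (ht : e * e * u * e * e = e * e)
    (hreg : ∃ b0, e * (1 - e * e * u) * b0 * (e * (1 - e * e * u)) = e * (1 - e * e * u)) :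
    ∃ b p : R, p * p = p ∧ p * e = e ∧ e * p = e ∧ b * e + e * b = p ∧ s * b = -(b * s) ∧
      s * p = p * s ∧ p * b = b ∧ b * p = b := by
  obtain ⟨b0, hb0⟩ := hreg
  obtain ⟨z, hz⟩ : ∃ z, z = 1 - e * e * u := ⟨_, rfl⟩
  rw [← hz] at hb0
  have hze : z * e = e * z := by
    rw [hz]; linear_combination (norm := noncomm_ring) -(e * e * hue)
  have hsee : s * (e * e) = e * e * s := by
    linear_combination (norm := noncomm_ring) hse * e - e * hse
  have hzs : z * s = s * z := by
    rw [hz]; linear_combination (norm := noncomm_ring) hsee * u - e * e * hus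
  have hezz : e * e * z = 0 := by
    have h : u * (e * e) = e * e * u := by
      linear_combination (norm := noncomm_ring) hue * e + e * hue
    rw [hz]
    linear_combination (norm := noncomm_ring) -ht + e * e * h
  have hzz : z * z = z := by
    have h : e * e * u * z = 0 := by
      have hzu : z * u = u * z := by
        have h : u * (e * e) = e * e * u := by
          linear_combination (norm := noncomm_ring) hue * e + e * hue
        rw [hz]
        linear_combination (norm := noncomm_ring) h * u
      linear_combination (norm := noncomm_ring) hezz * u - e * e * hzu
    have h' : e * e * u = 1 - z := by rw [hz]; abel
    rw [h'] at h
    linear_combination (norm := noncomm_ring) -h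
  obtain ⟨f, hf⟩ : ∃ f, f = e * z := ⟨_, rfl⟩
  rw [← hf] at hb0
  have hzf : z * f = f := by
    rw [hf]; linear_combination (norm := noncomm_ring) hze * z + e * hzz
  have hfz : f * z = f := by
    rw [hf]; linear_combination (norm := noncomm_ring) e * hzz
  have hff : f * f = 0 := by
    rw [hf]; linear_combination (norm := noncomm_ring) e * hze * z + hezz * z
  have hsf : s * f = - (f * s) := by
    rw [hf]; linear_combination (norm := noncomm_ring) hse * z + e * hzs
  -- make the quasi-inverse odd
  obtain ⟨b1, hb1⟩ : ∃ b1, b1 = (2⁻¹ : k) • (b0 - s * b0 * s) := ⟨_, rfl⟩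
  have two_b1 : b1 + b1 = b0 - s * b0 * s := by
    rw [hb1, ← two_smul k, smul_smul, mul_inv_cancel₀ two_ne_zero, one_smul]
  have cancel : ∀ x y : R, x + x = y + y → x = y := by
    intro x y h
    rw [← two_smul k, ← two_smul k] at h
    exact smul_right_injective _ two_ne_zero h
  have hsb1 : s * b1 = -(b1 * s) := by
    apply cancel
    have h1 : s * b1 + s * b1 = s * (b1 + b1) := by noncomm_ring
    have h2 : -(b1 * s) + -(b1 * s) = - ((b1 + b1) * s) := by noncomm_ring
    rw [h1, h2, two_b1]
    linear_combination (norm := noncomm_ring) - (hs * b0 * s) - s * b0 * hs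
  have hfb1 : f * b1 * f = f := by
    apply cancel
    have h1 : f * b1 * f + f * b1 * f = f * (b1 + b1) * f := by noncomm_ring
    rw [h1, two_b1]
    have h2 : f * (s * b0 * s) * f = s * (f * b0 * f) * s := by
      linear_combination (norm := noncomm_ring) hsf * b0 * s * f - s * f * b0 * hsf
    have h3 : f * (b0 - s * b0 * s) * f = f * b0 * f - f * (s * b0 * s) * f := by noncomm_ring
    rw [h3, h2, hb0]
    linear_combination (norm := noncomm_ring) -(hsf * s) + f * hs
  obtain ⟨b2, hb2⟩ : ∃ b2, b2 = z * b1 * z := ⟨_, rfl⟩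
  have hsb2 : s * b2 = -(b2 * s) := by
    rw [hb2]
    linear_combination (norm := noncomm_ring) - hzs * b1 * z + z * hsb1 * z + z * b1 * hzs
  have hfb2 : f * b2 * f = f := by
    rw [hb2]
    linear_combination (norm := noncomm_ring) hfz * b1 * z * f + f * b1 * hzf + hfb1
  have hzb2 : z * b2 = b2 := by
    rw [hb2]
    linear_combination (norm := noncomm_ring) hzz * b1 * z
  have hb2z : b2 * z = b2 := by
    rw [hb2]
    linear_combination (norm := noncomm_ring) z * b1 * hzz
  obtain ⟨c, hc, hsc, hcf, hfc, hcc⟩ := alg_nil f s b2 hff hsf hfb2 hsb2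
  have hzc : z * c = c := by
    rw [hc]; linear_combination (norm := noncomm_ring) hzb2 - hzf * b2 * b2
  have hcz : c * z = c := by
    rw [hc]; linear_combination (norm := noncomm_ring) hb2z - f * b2 * hb2z
  have hce : c * e = c * f := by
    rw [hf]; linear_combination (norm := noncomm_ring) -hcz * e + c * hze
  have hec : e * c = f * c := by
    rw [hf]; linear_combination (norm := noncomm_ring) -(e * hzc)
  obtain ⟨q, hq⟩ : ∃ q, q = c * f + f * c := ⟨_, rfl⟩
  rw [← hq] at hcf hfc hcc
  have hzq : z * q = q := by
    rw [hq]; linear_combination (norm := noncomm_ring) hzc * f + hzf * c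
  have hqz : q * z = q := by
    rw [hq]; linear_combination (norm := noncomm_ring) c * hfz + f * hcz
  have hqe : q * e = f := by
    rw [← hcf, hf]; linear_combination (norm := noncomm_ring) -hqz * e + q * hze
  have heq : e * q = f := by
    rw [← hfc, hf]; linear_combination (norm := noncomm_ring) -(e * hzq)
  obtain ⟨p, hp⟩ : ∃ p, p = 1 - z + q := ⟨_, rfl⟩
  have hpp : p * p = p := by
    rw [hp]
    linear_combination (norm := noncomm_ring) hzz - hzq - hqz + hcc
  have hpe : p * e = e := by
    rw [hp]
    linear_combination (norm := noncomm_ring) -hze + hqe + hf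
  have hep : e * p = e := by
    rw [hp]
    linear_combination (norm := noncomm_ring) heq + hf
  have hsq : s * q = q * s := by
    rw [hq]
    linear_combination (norm := noncomm_ring) hsc * f - c * hsf + hsf * c - f * hsc
  have hsp : s * p = p * s := by
    rw [hp]
    linear_combination (norm := noncomm_ring) hsq + hzs
  obtain ⟨d, hd⟩ : ∃ d, d = (2⁻¹ : k) • (e * u) := ⟨_, rfl⟩
  have two_d : d + d = e * u := by
    rw [hd, ← two_smul k, smul_smul, mul_inv_cancel₀ two_ne_zero, one_smul]
  have hde : d * e + e * d = 1 - z := by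
    apply cancel
    have h1 : d * e + e * d + (d * e + e * d) = (d + d) * e + e * (d + d) := by noncomm_ring
    rw [h1, two_d, hz]
    linear_combination (norm := noncomm_ring) e * hue
  have hsd : s * d = -(d * s) := by
    apply cancel
    have h1 : s * d + s * d = s * (d + d) := by noncomm_ring
    have h2 : -(d * s) + -(d * s) = - ((d + d) * s) := by noncomm_ring
    rw [h1, h2, two_d]
    linear_combination (norm := noncomm_ring) hse * u + e * hus
  have hb3 : (d + c) * e + e * (d + c) = p := by
    rw [hp]
    linear_combination (norm := noncomm_ring) hde + hce + hec - hq
  have hsb3 : s * (d + c) = -((d + c) * s) := by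
    linear_combination (norm := noncomm_ring) hsd + hsc
  generalize d + c = b3 at hb3 hsb3
  refine ⟨p * b3 * p, p, hpp, hpe, hep, ?_, ?_, hsp, ?_, ?_⟩
  · linear_combination (norm := noncomm_ring) p * b3 * hpe + hep * b3 * p + p * hb3 * p
      - p * b3 * hep - hpe * b3 * p + hpp * p + hpp
  · linear_combination (norm := noncomm_ring) hsp * b3 * p + p * hsb3 * p - p * b3 * hsp
  · linear_combination (norm := noncomm_ring) hpp * b3 * p
  · linear_combination (norm := noncomm_ring) p * b3 * hpp

end alg

end SupCat

namespace SupCat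

section modules

open GSupMod

set_option linter.unusedSectionVars false

variable {k : Type} [Field k] [CharZero k]

/-- existence of an odd contracting homotopy -/
def HasHtpy (M : GSupMod k (Fin 1)) : Prop :=
  ∃ b : M.carrier →ₗ[k] M.carrier, (∀ x, b (M.θ 0 x) + M.θ 0 (b x) = x) ∧
    ∀ x, M.sigma (b x) = - b (M.sigma x)

/-- the module induced from the even part -/
def indS (P : GSupMod k (Fin 1)) : GSupMod k (Fin 1) :=
  mkS (P.carrier × P.carrier) (LinearMap.prodMap P.sigma (-P.sigma))
    (LinearMap.prod (P.θ 0 ∘ₗ P.θ 0 ∘ₗ LinearMap.snd k _ _) (LinearMap.fst k _ _))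
    (by intro x; ext <;> simp [sigma_sigma])
    (by intro x; ext <;> simp [sigma_theta])

/-- the module coinduced from the even part -/
def coindS (P : GSupMod k (Fin 1)) : GSupMod k (Fin 1) :=
  mkS (P.carrier × P.carrier) (LinearMap.prodMap P.sigma (-P.sigma))
    (LinearMap.prod (LinearMap.snd k _ _) (P.θ 0 ∘ₗ P.θ 0 ∘ₗ LinearMap.fst k _ _))
    (by intro x; ext <;> simp [sigma_sigma])
    (by intro x; ext <;> simp [sigma_theta])

theorem indS_sigma (P : GSupMod k (Fin 1)) (x : P.carrier × P.carrier) :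
    ((indS P).sigma x : P.carrier × P.carrier) = (P.sigma x.1, -P.sigma x.2) :=
  mkS_sigma (P.carrier × P.carrier) _ _ _ _ x

theorem coindS_sigma (P : GSupMod k (Fin 1)) (x : P.carrier × P.carrier) :
    ((coindS P).sigma x : P.carrier × P.carrier) = (P.sigma x.1, -P.sigma x.2) :=
  mkS_sigma (P.carrier × P.carrier) _ _ _ _ x

theorem qcat_indS {P : GSupMod k (Fin 1)} (h : QCat k P) : QCat k (indS P) := by
  obtain ⟨m, hm, h0⟩ := qcat_poly h
  refine qcat_of_poly hm (LinearMap.ext fun x => ?_)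
  have h1 := aeval_intertwine (LinearMap.fst k P.carrier P.carrier)
    ((indS P).θ 0 ∘ₗ (indS P).θ 0) (P.θ 0 ∘ₗ P.θ 0) (fun _ => rfl) m x
  have h2 := aeval_intertwine (LinearMap.snd k P.carrier P.carrier)
    ((indS P).θ 0 ∘ₗ (indS P).θ 0) (P.θ 0 ∘ₗ P.θ 0) (fun _ => rfl) m x
  rw [h0] at h1 h2
  exact Prod.ext h1 h2

theorem qcat_coindS {P : GSupMod k (Fin 1)} (h : QCat k P) : QCat k (coindS P) := by
  obtain ⟨m, hm, h0⟩ := qcat_poly h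
  refine qcat_of_poly hm (LinearMap.ext fun x => ?_)
  have h1 := aeval_intertwine (LinearMap.fst k P.carrier P.carrier)
    ((coindS P).θ 0 ∘ₗ (coindS P).θ 0) (P.θ 0 ∘ₗ P.θ 0) (fun _ => rfl) m x
  have h2 := aeval_intertwine (LinearMap.snd k P.carrier P.carrier)
    ((coindS P).θ 0 ∘ₗ (coindS P).θ 0) (P.θ 0 ∘ₗ P.θ 0) (fun _ => rfl) m x
  rw [h0] at h1 h2
  exact Prod.ext h1 h2

theorem htpy_of_proj {P : GSupMod k (Fin 1)} (h : IsProjective (QCat k) P) : HasHtpy P := by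
  obtain ⟨hP, hl⟩ := h
  obtain ⟨g, hg, hg1⟩ := hl (indS P) P
    (LinearMap.fst k P.carrier P.carrier + P.θ 0 ∘ₗ LinearMap.snd k P.carrier P.carrier)
    LinearMap.id (qcat_indS hP) hP
    (by
      refine (isHom_iff _ _ _).2 ⟨?_, ?_⟩
      · intro x
        change P.θ 0 (P.θ 0 x.2) + P.θ 0 x.1 = P.θ 0 (x.1 + P.θ 0 x.2)
        rw [map_add, add_comm]
      · intro x
        have hx : (indS P).sigma x = ((P.sigma x.1, -P.sigma x.2) : P.carrier × P.carrier) :=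
          indS_sigma P x
        refine (congrArg _ hx).trans ?_
        change P.sigma x.1 + P.θ 0 (-P.sigma x.2) = P.sigma (x.1 + P.θ 0 x.2)
        rw [map_add, sigma_theta, map_neg])
    (by
      intro x
      refine ⟨((x, 0) : P.carrier × P.carrier), ?_⟩
      change x + P.θ 0 0 = x
      simp)
    (by rw [isHom_iff]; exact ⟨fun _ => rfl, fun _ => rfl⟩)
  obtain ⟨g0, gs⟩ := (isHom_iff _ _ _).1 hg
  refine ⟨LinearMap.snd k P.carrier P.carrier ∘ₗ g, ?_, ?_⟩
  · intro x
    have h1 : (g x : P.carrier × P.carrier).1 + P.θ 0 (g x : P.carrier × P.carrier).2 = x :=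
      LinearMap.congr_fun hg1 x
    have h2 : (g (P.θ 0 x) : P.carrier × P.carrier).2 = (g x : P.carrier × P.carrier).1 :=
      congrArg Prod.snd (g0 x)
    change (g (P.θ 0 x) : P.carrier × P.carrier).2 + P.θ 0 (g x : P.carrier × P.carrier).2 = x
    rw [h2, h1]
  · intro x
    have h1 : (g (P.sigma x) : P.carrier × P.carrier) = (P.sigma (g x : P.carrier × P.carrier).1,
        -P.sigma (g x : P.carrier × P.carrier).2) :=
      (gs x).trans (indS_sigma P (g x))
    have h2 : (g (P.sigma x) : P.carrier × P.carrier).2 = -P.sigma (g x : P.carrier × P.carrier).2 :=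
      congrArg Prod.snd h1
    change P.sigma (g x : P.carrier × P.carrier).2 = - (g (P.sigma x) : P.carrier × P.carrier).2
    rw [h2, neg_neg]

theorem htpy_of_inj {P : GSupMod k (Fin 1)} (h : IsInjective (QCat k) P) : HasHtpy P := by
  obtain ⟨hP, hl⟩ := h
  obtain ⟨g, hg, hg1⟩ := hl P (coindS P)
    (LinearMap.prod LinearMap.id (P.θ 0))
    LinearMap.id hP (qcat_coindS hP)
    (by
      refine (isHom_iff _ _ _).2 ⟨?_, ?_⟩
      · intro x
        rfl
      · intro x
        refine Eq.trans ?_ (coindS_sigma P _).symm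
        change ((P.sigma x, P.θ 0 (P.sigma x)) : P.carrier × P.carrier)
          = (P.sigma x, - P.sigma (P.θ 0 x))
        rw [sigma_theta, neg_neg])
    (by
      intro x y hxy
      exact congrArg Prod.fst hxy)
    (by rw [isHom_iff]; exact ⟨fun _ => rfl, fun _ => rfl⟩)
  obtain ⟨g0, gs⟩ := (isHom_iff _ _ _).1 hg
  let g' : P.carrier × P.carrier →ₗ[k] P.carrier := g
  have g0' : ∀ x : P.carrier × P.carrier, g' (x.2, P.θ 0 (P.θ 0 x.1)) = P.θ 0 (g' x) := g0
  have gs' : ∀ x : P.carrier × P.carrier, g' (P.sigma x.1, - P.sigma x.2) = P.sigma (g' x) := by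
    intro x
    exact (congrArg g (coindS_sigma P x)).symm.trans (gs x)
  have hg1' : ∀ x, g' (x, P.θ 0 x) = x := LinearMap.congr_fun hg1
  refine ⟨g' ∘ₗ LinearMap.inr k P.carrier P.carrier, ?_, ?_⟩
  · intro x
    have h1 := g0' (0, x)
    simp only [map_zero] at h1
    change g' (0, P.θ 0 x) + P.θ 0 (g' (0, x)) = x
    rw [← h1, ← map_add]
    simpa using hg1' x
  · intro x
    have h1 := gs' (0, x)
    simp only [map_zero] at h1
    change P.sigma (g' (0, x)) = - g' (0, P.sigma x)
    rw [← h1, ← map_neg g', Prod.neg_mk, neg_zero]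

/-- a graded, `t`-equivariant section of a surjection -/
theorem exists_section {M N : GSupMod k (Fin 1)} (π : M.carrier →ₗ[k] N.carrier)
    (hM : QCat k M) (hπ : IsHom M N π) (hs : Function.Surjective π) :
    ∃ s : N.carrier →ₗ[k] M.carrier, (∀ x, π (s x) = x) ∧
      (∀ x, s (N.θ 0 (N.θ 0 x)) = M.θ 0 (M.θ 0 (s x))) ∧
      (∀ x, s (N.sigma x) = M.sigma (s x)) := by
  obtain ⟨h0, h1⟩ := (isHom_iff _ _ _).1 hπ
  obtain ⟨W, hW, hc⟩ := hM (LinearMap.ker π) (by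
    intro m hm
    rw [LinearMap.mem_ker] at hm ⊢
    rw [h0, h0, hm, map_zero, map_zero])
  have hinj : Function.Injective (π ∘ₗ W.subtype) := by
    rw [← LinearMap.ker_eq_bot, LinearMap.ker_eq_bot']
    intro m hm
    have : (m : M.carrier) ∈ LinearMap.ker π ⊓ W := ⟨hm, m.2⟩
    rw [hc.inf_eq_bot] at this
    exact Subtype.ext this
  have hsurj : Function.Surjective (π ∘ₗ W.subtype) := by
    intro y
    obtain ⟨x, rfl⟩ := hs y
    have hx : x ∈ LinearMap.ker π ⊔ W := by rw [hc.sup_eq_top]; trivial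
    obtain ⟨a, ha, b, hb, rfl⟩ := Submodule.mem_sup.1 hx
    refine ⟨⟨b, hb⟩, ?_⟩
    rw [LinearMap.mem_ker] at ha
    simp [ha]
  let φ := LinearEquiv.ofBijective (π ∘ₗ W.subtype) ⟨hinj, hsurj⟩
  let s0 : N.carrier →ₗ[k] M.carrier := W.subtype ∘ₗ φ.symm.toLinearMap
  have hs0 : ∀ x, π (s0 x) = x := fun x => φ.apply_symm_apply x
  have hs0W : ∀ x, s0 x ∈ W := fun x => (φ.symm x).2
  have hWinj : ∀ a ∈ W, ∀ b ∈ W, π a = π b → a = b := by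
    intro a ha b hb hab
    have := @hinj ⟨a, ha⟩ ⟨b, hb⟩ hab
    exact congrArg Subtype.val this
  have hst : ∀ x, s0 (N.θ 0 (N.θ 0 x)) = M.θ 0 (M.θ 0 (s0 x)) := by
    intro x
    apply hWinj _ (hs0W _) _ (hW _ (hs0W _))
    rw [hs0, h0, h0, hs0]
  refine ⟨(2⁻¹ : k) • (s0 + M.sigma ∘ₗ s0 ∘ₗ N.sigma), ?_, ?_, ?_⟩
  · intro x
    simp only [LinearMap.smul_apply, LinearMap.add_apply, LinearMap.comp_apply, map_smul, map_add,
      h1, hs0, sigma_sigma]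
    rw [← two_smul k x, smul_smul, inv_mul_cancel₀ two_ne_zero, one_smul]
  · intro x
    simp [sigma_theta, hst]
  · intro x
    simp only [LinearMap.smul_apply, LinearMap.add_apply, LinearMap.comp_apply, map_smul, map_add,
      sigma_sigma]
    rw [add_comm]

theorem proj_of_htpy {P : GSupMod k (Fin 1)} (hP : QCat k P) (hb : HasHtpy P) :
    IsProjective (QCat k) P := by
  refine ⟨hP, ?_⟩
  intro M N π f hM hN hπ hs hf
  obtain ⟨b, hb, hbs⟩ := hb
  obtain ⟨s, hs1, hs2, hs3⟩ := exists_section π hM hπ hs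
  obtain ⟨p0, p1⟩ := (isHom_iff _ _ _).1 hπ
  obtain ⟨f0, f1⟩ := (isHom_iff _ _ _).1 hf
  have hbt : ∀ x, b (P.θ 0 (P.θ 0 x)) = P.θ 0 (P.θ 0 (b x)) := by
    intro x
    have h1 := hb (P.θ 0 x)
    have h2 := congrArg (P.θ 0) (hb x)
    rw [map_add] at h2
    exact add_left_cancel ((add_comm _ _).trans (h1.trans h2.symm))
  refine ⟨M.θ 0 ∘ₗ s ∘ₗ f ∘ₗ b + s ∘ₗ f ∘ₗ b ∘ₗ P.θ 0, ?_, ?_⟩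
  · rw [isHom_iff]
    constructor
    · intro x
      simp only [LinearMap.add_apply, LinearMap.comp_apply, map_add]
      rw [hbt, f0, f0, hs2, add_comm]
    · intro x
      have hth : P.θ 0 (P.sigma x) = - P.sigma (P.θ 0 x) := by rw [sigma_theta, neg_neg]
      have hb' : ∀ x, b (P.sigma x) = - P.sigma (b x) := by intro x; rw [hbs, neg_neg]
      have hth' : ∀ y, M.θ 0 (M.sigma y) = - M.sigma (M.θ 0 y) := by
        intro y; rw [sigma_theta, neg_neg]
      simp only [LinearMap.add_apply, LinearMap.comp_apply, map_add, hth, hb', map_neg, f1, hs3,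
        hth', neg_neg]
  · ext x
    simp only [LinearMap.add_apply, LinearMap.comp_apply, map_add, p0, hs1]
    rw [← f0, ← map_add, add_comm, hb]

theorem exists_decomp {M : GSupMod k (Fin 1)} (hM : QCat k M) :
    ∃ b p : M.carrier →ₗ[k] M.carrier, (∀ x, p (p x) = p x) ∧ (∀ x, p (M.θ 0 x) = M.θ 0 x) ∧
      (∀ x, M.θ 0 (p x) = M.θ 0 x) ∧ (∀ x, b (M.θ 0 x) + M.θ 0 (b x) = p x) ∧
      (∀ x, M.sigma (b x) = - b (M.sigma x)) ∧ (∀ x, M.sigma (p x) = p (M.sigma x)) ∧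
      (∀ x, p (b x) = b x) := by
  obtain ⟨u, hu1, hu2, hu3⟩ := exists_pinv hM
  let R := Module.End k M.carrier
  let e : R := M.θ 0
  let s : R := M.sigma
  let u' : R := u
  obtain ⟨g, hg⟩ := exists_reg (e * (1 - e * e * u'))
  have hut : ∀ x, u (M.θ 0 (M.θ 0 x)) = M.θ 0 (M.θ 0 (u x)) := by
    intro x; rw [hu1, hu1]
  obtain ⟨b, p, h1, h2, h3, h4, h5, h6, h7, -⟩ := alg_main (k := k) e s u'
    (LinearMap.ext fun x => sigma_sigma M x)
    (LinearMap.ext fun x => sigma_theta M 0 x)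
    (LinearMap.ext fun x => hu1 x) (LinearMap.ext fun x => hu2 x)
    (LinearMap.ext fun x => hu3 x)
    ⟨g, LinearMap.ext fun x => hg x⟩
  exact ⟨b, p, LinearMap.congr_fun h1, LinearMap.congr_fun h2, LinearMap.congr_fun h3,
    LinearMap.congr_fun h4, LinearMap.congr_fun h5, LinearMap.congr_fun h6,
    LinearMap.congr_fun h7⟩

/-- the summand cut out by an idempotent -/
def subS (M : GSupMod k (Fin 1)) (p : M.carrier →ₗ[k] M.carrier)
    (hpe : ∀ x, M.θ 0 (p x) = p (M.θ 0 x)) (hps : ∀ x, M.sigma (p x) = p (M.sigma x)) :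
    GSupMod k (Fin 1) :=
  mkS (LinearMap.range p)
    (M.sigma.restrict (by rintro _ ⟨x, rfl⟩; exact ⟨_, (hps x).symm⟩))
    ((M.θ 0).restrict (by rintro _ ⟨x, rfl⟩; exact ⟨_, (hpe x).symm⟩))
    (by intro x; exact Subtype.ext (sigma_sigma M x))
    (by intro x; exact Subtype.ext (sigma_theta M 0 x))

theorem subS_sigma (M : GSupMod k (Fin 1)) (p : M.carrier →ₗ[k] M.carrier)
    (hpe : ∀ x, M.θ 0 (p x) = p (M.θ 0 x)) (hps : ∀ x, M.sigma (p x) = p (M.sigma x))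
    (x : LinearMap.range p) :
    Subtype.val (p := fun y => y ∈ LinearMap.range p) ((subS M p hpe hps).sigma x) = M.sigma x :=
  congrArg Subtype.val (mkS_sigma (LinearMap.range p) _ _ _ _ x)

theorem isDsum_subS (M : GSupMod k (Fin 1)) (p q : M.carrier →ₗ[k] M.carrier) (hq : q = LinearMap.id - p)
    (hpp : ∀ x, p (p x) = p x)
    (hpe : ∀ x, M.θ 0 (p x) = p (M.θ 0 x)) (hps : ∀ x, M.sigma (p x) = p (M.sigma x))
    (hqe : ∀ x, M.θ 0 (q x) = q (M.θ 0 x))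
    (hqs : ∀ x, M.sigma (q x) = q (M.sigma x)) :
    IsDsum (subS M q hqe hqs) (subS M p hpe hps) M := by
  have hqx : ∀ x, q x = x - p x := by intro x; rw [hq]; rfl
  rw [isDsum_iff]
  let f : M.carrier →ₗ[k] LinearMap.range q × LinearMap.range p :=
    LinearMap.prod q.rangeRestrict p.rangeRestrict
  let g : LinearMap.range q × LinearMap.range p →ₗ[k] M.carrier :=
    LinearMap.coprod (Submodule.subtype _) (Submodule.subtype _)
  have hq0 : ∀ y ∈ LinearMap.range q, p y = 0 := by
    rintro _ ⟨x, rfl⟩; simp [hpp, hqx]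
  have hp0 : ∀ y ∈ LinearMap.range p, p y = y := by
    rintro _ ⟨x, rfl⟩; simp [hpp]
  let φ : M.carrier ≃ₗ[k] LinearMap.range q × LinearMap.range p :=
    LinearEquiv.ofLinearMap f g
      (by
        refine LinearMap.ext fun x => ?_
        obtain ⟨⟨a, ha⟩, ⟨c, hc⟩⟩ := x
        have h1 := hq0 a ha
        have h2 := hp0 c hc
        ext <;> simp [f, g, h1, h2, hqx])
      (by ext x; simp [f, g, hqx])
  refine ⟨φ, ?_, ?_⟩
  · intro x
    refine Prod.ext ?_ ?_
    · exact Subtype.ext ((hqs x).symm.trans (subS_sigma M q hqe hqs (q.rangeRestrict x)).symm)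
    · exact Subtype.ext ((hps x).symm.trans (subS_sigma M p hpe hps (p.rangeRestrict x)).symm)
  · intro x
    refine Prod.ext ?_ ?_
    · exact Subtype.ext (hqe x).symm
    · exact Subtype.ext (hpe x).symm

end modules

end SupCat

namespace SupCat

section endo

open GSupMod

set_option linter.unusedSectionVars false

variable {k : Type} [Field k] [CharZero k]

/-- the sign of a parity -/
def sg (k : Type) [Field k] (p : Bool) : k := if p then -1 else 1

theorem isTrivial_iff (p : Bool) (M : GSupMod k (Fin 1)) :
    IsTrivial p M ↔ Module.finrank k M.carrier = 1 ∧ (∀ x, M.θ 0 x = 0) ∧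
      ∀ x, M.sigma x = sg k p • x := by
  unfold IsTrivial
  refine and_congr_right fun _ => and_congr ?_ ?_
  · rw [Fin.forall_fin_one]; exact LinearMap.ext_iff
  · cases p
    · simp [sg, Submodule.eq_top_iff', mem_ev_iff]
    · simp [sg, Submodule.eq_top_iff', mem_od_iff]

theorem isTrivial_congr {p : Bool} {A B : GSupMod k (Fin 1)} (f : A.carrier ≃ₗ[k] B.carrier)
    (h0 : ∀ x, f (A.θ 0 x) = B.θ 0 (f x)) (h1 : ∀ x, f (A.sigma x) = B.sigma (f x))
    (h : IsTrivial p A) : IsTrivial p B := by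
  rw [isTrivial_iff] at h ⊢
  obtain ⟨a, b, c⟩ := h
  refine ⟨f.finrank_eq ▸ a, fun x => ?_, fun x => ?_⟩
  · obtain ⟨x, rfl⟩ := f.surjective x; rw [← h0, b, map_zero]
  · obtain ⟨x, rfl⟩ := f.surjective x; rw [← h1, c, map_smul]

theorem dsum_zero_right {A B S : GSupMod k (Fin 1)} (h : IsDsum A B S) (hB : ∀ b : B.carrier, b = 0) :
    ∃ f : S.carrier ≃ₗ[k] A.carrier, (∀ x, f (S.θ 0 x) = A.θ 0 (f x)) ∧
      ∀ x, f (S.sigma x) = A.sigma (f x) := by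
  obtain ⟨φ, h1, h0⟩ := (isDsum_iff _ _ _).1 h
  refine ⟨LinearEquiv.ofBijective (LinearMap.fst k _ _ ∘ₗ φ.toLinearMap) ⟨?_, ?_⟩, ?_, ?_⟩
  · intro x y hxy
    exact φ.injective (Prod.ext hxy ((hB _).trans (hB _).symm))
  · intro a
    exact ⟨φ.symm (a, 0), by simp⟩
  · intro x
    exact congrArg Prod.fst (h0 x)
  · intro x
    exact congrArg Prod.fst (h1 x)

/-- the super action on endomorphisms -/
def actE (M : GSupMod k (Fin 1)) (x : M.carrier →ₗ[k] M.carrier) : M.carrier →ₗ[k] M.carrier :=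
  M.θ 0 ∘ₗ x - (M.sigma ∘ₗ x ∘ₗ M.sigma) ∘ₗ M.θ 0

theorem endo_model {M : GSupMod k (Fin 1)} (h : IsEndotrivial (QCat k) M) :
    ∃ (K P : GSupMod k (Fin 1)) (Φ : (M.carrier →ₗ[k] M.carrier) ≃ₗ[k] K.carrier × P.carrier),
      Module.finrank k K.carrier = 1 ∧ HasHtpy P ∧
      ∀ x, Φ (actE M x) = (0, P.θ 0 (Φ x).2) := by
  obtain ⟨hM, H, K, P, S, ⟨φ, -, -, hφ⟩, hH, hK, hP, hS, χ, hχ⟩ := h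
  obtain ⟨ψ, -, hψ⟩ := (isDsum_iff _ _ _).1 hS
  obtain ⟨hK1, hK2, -⟩ := (isTrivial_iff _ _).1 hK
  refine ⟨K, P, φ.symm.trans (χ.trans ψ), hK1, htpy_of_proj hP, fun x => ?_⟩
  have h1 : φ.symm (actE M x) = H.θ 0 (φ.symm x) := by
    rw [LinearEquiv.symm_apply_eq, hφ, LinearEquiv.apply_symm_apply]; rfl
  have h2 : χ (H.θ 0 (φ.symm x)) = S.θ 0 (χ (φ.symm x)) := ((isHom_iff _ _ _).1 hχ).1 _
  simp only [LinearEquiv.trans_apply]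
  rw [h1, h2, hψ, hK2]

theorem endo_rank {M : GSupMod k (Fin 1)} (h : IsEndotrivial (QCat k) M)
    (b p q : M.carrier →ₗ[k] M.carrier) (hq : ∀ x, q x = x - p x)
    (hpp : ∀ x, p (p x) = p x) (hpe : ∀ x, p (M.θ 0 x) = M.θ 0 x)
    (hep : ∀ x, M.θ 0 (p x) = M.θ 0 x) (hb : ∀ x, b (M.θ 0 x) + M.θ 0 (b x) = p x)
    (hbs : ∀ x, M.sigma (b x) = - b (M.sigma x)) :
    Module.finrank k (LinearMap.range q) = 1 := by
  obtain ⟨K, P, Φ, hK, ⟨c, hc, -⟩, hΦ⟩ := endo_model h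
  have hqe : ∀ x, q (M.θ 0 x) = 0 := by intro x; rw [hq, hpe, sub_self]
  have heq : ∀ x, M.θ 0 (q x) = 0 := by intro x; rw [hq, map_sub, hep, sub_self]
  have hqq : ∀ y ∈ LinearMap.range q, q y = y := by
    rintro _ ⟨x, rfl⟩; simp [hq, hpp]
  have heq' : ∀ y ∈ LinearMap.range q, M.θ 0 y = 0 := by
    rintro _ ⟨x, rfl⟩; exact heq x
  have hle : Module.finrank k (LinearMap.range q) ≤ 1 := by
    let G : (LinearMap.range q →ₗ[k] LinearMap.range q) →ₗ[k] (M.carrier →ₗ[k] M.carrier) :=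
      { toFun := fun g => (LinearMap.range q).subtype ∘ₗ g ∘ₗ q.rangeRestrict
        map_add' := by intro x y; ext z; simp
        map_smul' := by intro a x; ext z; simp }
    let F : (LinearMap.range q →ₗ[k] LinearMap.range q) →ₗ[k] K.carrier :=
      LinearMap.fst k _ _ ∘ₗ Φ.toLinearMap ∘ₗ G
    have hF : Function.Injective F := by
      rw [← LinearMap.ker_eq_bot, LinearMap.ker_eq_bot']
      intro g hg
      have hg' : (Φ (G g)).1 = 0 := hg
      have hG : ∀ v, G g v = g (q.rangeRestrict v) := fun v => rfl
      have hact : actE M (G g) = 0 := by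
        ext v
        have h1 : M.θ 0 (G g v) = 0 := by rw [hG]; exact heq' _ (Subtype.prop _)
        have h2 : G g (M.sigma (M.θ 0 v)) = 0 := by
          have h3 : q.rangeRestrict (M.sigma (M.θ 0 v)) = 0 := by
            apply Subtype.ext
            change q (M.sigma (M.θ 0 v)) = 0
            rw [sigma_theta, map_neg, hqe, neg_zero]
          rw [hG, h3, map_zero]; rfl
        change M.θ 0 (G g v) - M.sigma (G g (M.sigma (M.θ 0 v))) = 0
        rw [h1, h2, map_zero, sub_zero]
      have hw : P.θ 0 (Φ (G g)).2 = 0 := by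
        have := hΦ (G g)
        rw [hact, map_zero] at this
        exact (congrArg Prod.snd this).symm
      have hy : actE M (Φ.symm (0, c (Φ (G g)).2)) = G g := by
        apply Φ.injective
        rw [hΦ, LinearEquiv.apply_symm_apply]
        refine Prod.ext hg'.symm ?_
        have := hc (Φ (G g)).2
        rw [hw, map_zero, zero_add] at this
        exact this
      generalize Φ.symm (0, c (Φ (G g)).2) = y at hy
      ext v
      have h1 : q.rangeRestrict v = v := Subtype.ext (hqq v v.2)
      have h2 := LinearMap.congr_fun hy v
      rw [hG, h1] at h2
      change M.θ 0 (y v) - M.sigma (y (M.sigma (M.θ 0 v))) = g v at h2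
      rw [heq' v v.2, map_zero, map_zero, map_zero, sub_zero] at h2
      have h3 := hqq _ (g v).2
      rw [← h2, hqe] at h3
      rw [← h2, ← h3]; rfl
    have h1 := LinearMap.finrank_le_finrank_of_injective hF
    rw [hK, Module.finrank_linearMap] at h1
    by_contra hcon
    push Not at hcon
    nlinarith
  have hne : Module.finrank k (LinearMap.range q) ≠ 0 := by
    intro h0
    have hbot : LinearMap.range q = ⊥ := Submodule.finrank_eq_zero.1 h0
    have hq0 : ∀ x, p x = x := by
      intro x
      have : q x ∈ LinearMap.range q := ⟨x, rfl⟩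
      rw [hbot, Submodule.mem_bot, hq, sub_eq_zero] at this
      exact this.symm
    obtain ⟨κ, hκ⟩ : ∃ κ : K.carrier, κ ≠ 0 := by
      have : Nontrivial K.carrier := Module.nontrivial_of_finrank_pos (R := k) (by omega)
      exact exists_ne 0
    have hx : actE M (Φ.symm (κ, 0)) = 0 := by
      apply Φ.injective
      rw [hΦ, LinearEquiv.apply_symm_apply]
      simp
    have hΦx : (Φ (Φ.symm (κ, 0))).1 = κ := by simp
    generalize Φ.symm (κ, 0) = x at hx hΦx
    have hx' : ∀ v, M.sigma (x (M.sigma (M.θ 0 v))) = M.θ 0 (x v) := by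
      intro v
      exact (sub_eq_zero.1 (LinearMap.congr_fun hx v)).symm
    have hy : actE M (b ∘ₗ x) = x := by
      ext v
      change M.θ 0 (b (x v)) - M.sigma (b (x (M.sigma (M.θ 0 v)))) = x v
      rw [hbs, hx', sub_neg_eq_add, add_comm, hb, hq0]
    apply hκ
    rw [← hΦx, ← hy, hΦ]
  omega

/-- structure of endotrivial modules -/
theorem endo_struct {M : GSupMod k (Fin 1)} (h : IsEndotrivial (QCat k) M) :
    ∃ (r : Bool) (C P : GSupMod k (Fin 1)), IsTrivial r C ∧ IsProjective (QCat k) P ∧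
      IsDsum C P M := by
  obtain ⟨b, p, hpp, hpe, hep, hb, hbs, hps, hpb⟩ := exists_decomp h.1
  have hqx : ∀ x, (LinearMap.id - p : M.carrier →ₗ[k] M.carrier) x = x - p x := fun _ => rfl
  generalize hq : (LinearMap.id - p : M.carrier →ₗ[k] M.carrier) = q at hqx
  have hrank := endo_rank h b p q hqx hpp hpe hep hb hbs
  have hep' : ∀ x, M.θ 0 (p x) = p (M.θ 0 x) := by intro x; rw [hep, hpe]
  have hqe : ∀ x, M.θ 0 (q x) = q (M.θ 0 x) := by intro x; rw [hqx, hqx, map_sub, hep']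
  have hqs : ∀ x, M.sigma (q x) = q (M.sigma x) := by intro x; rw [hqx, hqx, map_sub, hps]
  have hds := isDsum_subS M p q hq.symm hpp hep' hps hqe hqs
  obtain ⟨v, hv0, hv⟩ := finrank_eq_one_iff'.1 hrank
  have hsv : M.sigma v ∈ LinearMap.range q := by
    obtain ⟨y, hy⟩ := v.2
    exact ⟨M.sigma y, by rw [← hqs, hy]⟩
  obtain ⟨c, hc⟩ := hv ⟨_, hsv⟩
  have hc : c • (v : M.carrier) = M.sigma v := congrArg Subtype.val hc
  have hv0' : (v : M.carrier) ≠ 0 := fun h => hv0 (Subtype.ext h)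
  have hcc : c * c = 1 := by
    have h1 := sigma_sigma M v
    rw [← hc, map_smul, ← hc, smul_smul] at h1
    have h2 : (c * c - 1) • (v : M.carrier) = 0 := by rw [sub_smul, h1, one_smul, sub_self]
    exact sub_eq_zero.1 ((smul_eq_zero.1 h2).resolve_right hv0')
  obtain ⟨r, hr⟩ : ∃ r, c = sg k r := by
    rcases mul_self_eq_one_iff.1 hcc with h | h
    · exact ⟨false, h⟩
    · exact ⟨true, h⟩
  refine ⟨r, _, _, (isTrivial_iff _ _).2 ⟨hrank, ?_, ?_⟩, proj_of_htpy ?_ ?_, hds⟩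
  · rintro ⟨_, x, rfl⟩
    apply Subtype.ext
    change M.θ 0 (q x) = 0
    rw [hqx, map_sub, hep, sub_self]
  · intro y
    obtain ⟨a, ha⟩ := hv y
    have ha' : a • (v : M.carrier) = Subtype.val (p := fun z => z ∈ LinearMap.range q) y :=
      congrArg Subtype.val ha
    refine Subtype.ext ((subS_sigma M q hqe hqs y).trans ?_)
    change _ = sg k r • Subtype.val (p := fun z => z ∈ LinearMap.range q) y
    rw [← ha', map_smul, ← hc, hr, smul_comm]
  · exact qcat_of_inj (B := M) (LinearMap.range p).subtype (Submodule.subtype_injective _)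
      (fun _ => rfl) h.1
  · refine ⟨b.restrict (p := LinearMap.range p) (q := LinearMap.range p)
      (fun x _ => ⟨b x, hpb x⟩), ?_, ?_⟩
    · rintro ⟨_, x, rfl⟩
      apply Subtype.ext
      change b (M.θ 0 (p x)) + M.θ 0 (b (p x)) = p x
      rw [hb, hpp]
    · intro x
      refine Subtype.ext ((subS_sigma M p hep' hps _).trans ?_)
      refine (hbs _).trans ?_
      exact congrArg (fun z => - b z) (subS_sigma M p hep' hps x).symm

theorem part_one {M : GSupMod k (Fin 1)} (hi : Indecomposable M)
    (h : IsEndotrivial (QCat k) M) : ∃ p : Bool, IsTrivial p M := by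
  obtain ⟨r, C, P, hC, hP, hd⟩ := endo_struct h
  refine ⟨r, ?_⟩
  rcases hi.2 C P hd with h0 | h0
  · exfalso
    have : Nontrivial C.carrier := Module.nontrivial_of_finrank_pos (R := k) (by rw [hC.1]; omega)
    obtain ⟨c, hc⟩ := exists_ne (0 : C.carrier)
    exact hc (h0 c)
  · obtain ⟨f, f0, f1⟩ := dsum_zero_right hd h0
    refine isTrivial_congr f.symm ?_ ?_ hC
    · intro x; rw [LinearEquiv.symm_apply_eq, f0, LinearEquiv.apply_symm_apply]
    · intro x; rw [LinearEquiv.symm_apply_eq, f1, LinearEquiv.apply_symm_apply]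

end endo

end SupCat

namespace SupCat

section omega

open GSupMod

set_option linter.unusedSectionVars false

variable {k : Type} [Field k] [CharZero k]

theorem sg_not (r : Bool) : sg k (!r) = - sg k r := by
  cases r <;> simp [sg]

theorem sg_mul_self (r : Bool) : sg k r * sg k r = 1 := by
  cases r <;> simp [sg]

/-- the two-dimensional projective module of the principal block -/
def stdR (k : Type) [Field k] [CharZero k] (r : Bool) : GSupMod k (Fin 1) :=
  mkS (k × k) (LinearMap.prodMap (sg k r • LinearMap.id) (-(sg k r) • LinearMap.id))
    (LinearMap.prod 0 (LinearMap.fst k k k))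
    (by intro x; ext <;> simp [← mul_assoc, sg_mul_self])
    (by intro x; ext <;> simp)

theorem stdR_sigma (r : Bool) (x : k × k) :
    ((stdR k r).sigma x : k × k) = (sg k r * x.1, -(sg k r) * x.2) :=
  mkS_sigma (k × k) _ _ _ _ x

theorem stdR_theta (r : Bool) (x : k × k) :
    ((stdR k r).θ 0 x : k × k) = (0, x.1) := rfl

theorem qcat_stdR (r : Bool) : QCat k (stdR k r) := qcat_of_sq_zero fun _ => rfl

theorem trivial_spans {r : Bool} {L : GSupMod k (Fin 1)} (h : IsTrivial r L) {y : L.carrier}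
    (hy : y ≠ 0) (z : L.carrier) : ∃ a : k, a • y = z :=
  (finrank_eq_one_iff_of_nonzero' y hy).1 h.1 z

theorem trivial_exists {r : Bool} {L : GSupMod k (Fin 1)} (h : IsTrivial r L) :
    ∃ y : L.carrier, y ≠ 0 := by
  have : Nontrivial L.carrier := Module.nontrivial_of_finrank_pos (R := k) (by rw [h.1]; omega)
  exact exists_ne 0

theorem trivial_of_gen {r : Bool} {N : GSupMod k (Fin 1)} (n : N.carrier) (hn : n ≠ 0)
    (hspan : ∀ z : N.carrier, ∃ a : k, a • n = z) (h0 : N.θ 0 n = 0)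
    (h1 : N.sigma n = sg k r • n) : IsTrivial r N := by
  refine (isTrivial_iff _ _).2 ⟨finrank_eq_one_iff'.2 ⟨n, hn, hspan⟩, ?_, ?_⟩
  · intro x; obtain ⟨a, rfl⟩ := hspan x; rw [map_smul, h0, smul_zero]
  · intro x; obtain ⟨a, rfl⟩ := hspan x; rw [map_smul, h1, smul_comm]

theorem syzygy_trivial {r : Bool} {L N : GSupMod k (Fin 1)} (hL : IsTrivial r L)
    (h : IsSyzygy (QCat k) L N) : IsTrivial (!r) N := by
  obtain ⟨hN, P, π, i, ⟨hP, hπ, hπs, hmin⟩, hi, hinj, hrk⟩ := h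
  obtain ⟨b, hb, -⟩ := htpy_of_proj hP
  obtain ⟨p0, p1⟩ := (isHom_iff _ _ _).1 hπ
  obtain ⟨i0, i1⟩ := (isHom_iff _ _ _).1 hi
  obtain ⟨-, L0, L1⟩ := (isTrivial_iff _ _).1 hL
  obtain ⟨u, u0, u1, u2⟩ := exists_pinv hP.1
  obtain ⟨x, hx, hxs, hxt⟩ : ∃ x, π x ≠ 0 ∧ P.sigma x = sg k r • x ∧ P.θ 0 (P.θ 0 x) = 0 := by
    obtain ⟨y, hy⟩ := trivial_exists hL
    obtain ⟨x0, rfl⟩ := hπs y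
    obtain ⟨x1, hx1⟩ : ∃ x1, x1 = x0 + sg k r • P.sigma x0 := ⟨_, rfl⟩
    have h1 : π x1 = (2 : k) • π x0 := by
      rw [hx1, map_add, map_smul, p1, L1, smul_smul, sg_mul_self, one_smul, two_smul]
    have h2 : P.sigma x1 = sg k r • x1 := by
      rw [hx1, map_add, map_smul, sigma_sigma, smul_add, smul_smul, sg_mul_self, one_smul, add_comm]
    refine ⟨x1 - P.θ 0 (P.θ 0 (u x1)), ?_, ?_, ?_⟩
    · rw [map_sub, p0, L0, sub_zero, h1]
      exact smul_ne_zero two_ne_zero hy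
    · rw [map_sub, sigma_theta, sigma_theta, map_neg, neg_neg, ← u1, h2, smul_sub]
      simp only [map_smul]
    · simp only [map_sub]
      rw [← u0, ← u0, u2, sub_self]
  let f : k × k →ₗ[k] P.carrier :=
    LinearMap.coprod (LinearMap.toSpanSingleton k _ x) (LinearMap.toSpanSingleton k _ (P.θ 0 x))
  have hfx : ∀ y : k × k, f y = y.1 • x + y.2 • P.θ 0 x := fun y => by simp [f]
  have key0 : ∀ y : k × k, f (0, y.1) = P.θ 0 (f y) := by
    intro y
    rw [hfx, hfx]
    simp [hxt]
  have key1 : ∀ y : k × k, f (sg k r * y.1, -(sg k r) * y.2) = P.sigma (f y) := by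
    intro y
    rw [hfx, hfx, map_add, map_smul, map_smul, sigma_theta, hxs, map_smul, smul_smul, smul_neg,
      smul_smul, neg_mul, neg_smul, mul_comm, mul_comm (sg k r)]
  have hfs : Function.Surjective f := by
    refine hmin (stdR k r) f (qcat_stdR r) ?_ ?_
    · refine (isHom_iff _ _ _).2 ⟨?_, ?_⟩
      · exact fun y => key0 y
      · exact fun y => (congrArg f (stdR_sigma r y)).trans (key1 y)
    · intro z
      obtain ⟨a, ha⟩ := trivial_spans hL hx z
      refine ⟨((a, 0) : k × k), ?_⟩
      change π (f (a, 0)) = z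
      rw [hfx, ← ha]; simp
  have hex : P.θ 0 x ≠ 0 := by
    intro h0
    have hall : ∀ y, P.θ 0 y = 0 := by
      intro y
      obtain ⟨c, rfl⟩ := hfs y
      rw [hfx, map_add, map_smul, map_smul, hxt, h0, smul_zero, smul_zero, add_zero]
    have h1 := hb x
    rw [hall, hall, map_zero, add_zero] at h1
    exact hx (by rw [← h1, map_zero])
  have hker : P.θ 0 x ∈ LinearMap.range i := by
    rw [hrk, LinearMap.mem_ker, p0, L0]
  obtain ⟨n, hn⟩ := hker
  refine trivial_of_gen n ?_ ?_ ?_ ?_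
  · rintro rfl; exact hex (by rw [← hn, map_zero])
  · intro m
    have hm : i m ∈ LinearMap.ker π := by rw [← hrk]; exact ⟨m, rfl⟩
    obtain ⟨c, hc⟩ := hfs (i m)
    rw [LinearMap.mem_ker, ← hc, hfx, map_add, map_smul, map_smul, p0, L0, smul_zero, add_zero,
      smul_eq_zero, or_iff_left hx] at hm
    refine ⟨c.2, hinj ?_⟩
    rw [← hc, hfx, hm, map_smul, hn, zero_smul, zero_add]
  · apply hinj
    rw [i0, hn, hxt, map_zero]
  · apply hinj
    rw [i1, hn, sigma_theta, hxs, map_smul, map_smul, hn, sg_not, neg_smul]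

theorem cosyzygy_trivial {r : Bool} {L N : GSupMod k (Fin 1)} (hL : IsTrivial r L)
    (h : IsCosyzygy (QCat k) L N) : IsTrivial (!r) N := by
  obtain ⟨hN, I, j, p, ⟨hI, hj, hjinj, hmin⟩, hp, hps, hrk⟩ := h
  obtain ⟨b, hb, hbs⟩ := htpy_of_inj hI
  obtain ⟨p0, p1⟩ := (isHom_iff _ _ _).1 hp
  obtain ⟨j0, j1⟩ := (isHom_iff _ _ _).1 hj
  obtain ⟨-, L0, L1⟩ := (isTrivial_iff _ _).1 hL
  obtain ⟨u, u0, u1, u2⟩ := exists_pinv hI.1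
  obtain ⟨y, hy⟩ := trivial_exists hL
  obtain ⟨v, hv⟩ : ∃ v, v = j y := ⟨_, rfl⟩
  have hv0 : v ≠ 0 := by
    rintro rfl
    exact hy (hjinj (by rw [← hv, map_zero]))
  have hve : I.θ 0 v = 0 := by rw [hv, ← j0, L0, map_zero]
  have hvs : I.sigma v = sg k r • v := by rw [hv, ← j1, L1, map_smul]
  obtain ⟨w, hw⟩ : ∃ w, w = b v := ⟨_, rfl⟩
  have hwe : I.θ 0 w = v := by
    have := hb v
    rwa [hve, map_zero, zero_add, ← hw] at this
  have hws : I.sigma w = sg k (!r) • w := by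
    rw [hw, hbs, hvs, map_smul, sg_not, neg_smul]
  obtain ⟨l, hlv, hlt, hls⟩ : ∃ l : I.carrier →ₗ[k] k, l v ≠ 0 ∧ (∀ x, l (I.θ 0 (I.θ 0 x)) = 0) ∧
      ∀ x, l (I.sigma x) = sg k r * l x := by
    obtain ⟨l0, hl0⟩ : ∃ l0 : I.carrier →ₗ[k] k, l0 v ≠ 0 := by
      by_contra hcon
      push Not at hcon
      exact hv0 ((Module.forall_dual_apply_eq_zero_iff k v).1 hcon)
    let l1 : I.carrier →ₗ[k] k := l0 ∘ₗ (LinearMap.id - I.θ 0 ∘ₗ I.θ 0 ∘ₗ u)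
    have hl1 : ∀ x, l1 x = l0 x - l0 (I.θ 0 (I.θ 0 (u x))) := fun x => by simp [l1]
    have hl1t : ∀ x, l1 (I.θ 0 (I.θ 0 x)) = 0 := by
      intro x; rw [hl1, u2, sub_self]
    have hl1v : l1 v = l0 v := by
      rw [hl1, ← u0, hve]; simp
    refine ⟨l1 + sg k r • (l1 ∘ₗ I.sigma), ?_, ?_, ?_⟩
    · simp only [LinearMap.add_apply, LinearMap.smul_apply, LinearMap.comp_apply, hvs, map_smul,
        smul_smul, sg_mul_self, one_smul, hl1v, ← two_mul]
      exact mul_ne_zero two_ne_zero hl0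
    · intro x
      simp only [LinearMap.add_apply, LinearMap.smul_apply, LinearMap.comp_apply, sigma_theta,
        map_neg, neg_neg, hl1t, smul_zero, add_zero]
    · intro x
      simp only [LinearMap.add_apply, LinearMap.smul_apply, LinearMap.comp_apply, sigma_sigma,
        smul_eq_mul, mul_add, ← mul_assoc, sg_mul_self, one_mul]
      rw [add_comm]
  let f : I.carrier →ₗ[k] k × k := LinearMap.prod (l ∘ₗ I.θ 0) l
  have hf : ∀ x, f x = (l (I.θ 0 x), l x) := fun _ => rfl
  have key0 : ∀ x, f (I.θ 0 x) = (0, (f x).1) := by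
    intro x
    rw [hf, hf, hlt]
  have key1 : ∀ x, f (I.sigma x) = (sg k (!r) * (f x).1, -(sg k (!r)) * (f x).2) := by
    intro x
    rw [hf, hf]
    have : I.θ 0 (I.sigma x) = - I.sigma (I.θ 0 x) := by rw [sigma_theta, neg_neg]
    rw [this, map_neg, hls, hls, sg_not, neg_neg, neg_mul]
  have hfinj : Function.Injective f := by
    refine hmin (stdR k (!r)) f (qcat_stdR _) ?_ ?_
    · refine (isHom_iff _ _ _).2 ⟨?_, ?_⟩
      · exact fun x => key0 x
      · exact fun x => (key1 x).trans (stdR_sigma (!r) (f x)).symm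
    · change Function.Injective (f ∘ₗ j)
      rw [← LinearMap.ker_eq_bot, LinearMap.ker_eq_bot']
      intro m hm
      obtain ⟨a, rfl⟩ := trivial_spans hL hy m
      have h2 : l (j (a • y)) = 0 := congrArg Prod.snd hm
      rw [map_smul, map_smul, ← hv, smul_eq_mul, mul_eq_zero, or_iff_left hlv] at h2
      rw [h2, zero_smul]
  have hpv : p v = 0 := by
    have : v ∈ LinearMap.ker p := by rw [hrk, hv]; exact ⟨y, rfl⟩
    exact this
  refine trivial_of_gen (p w) ?_ ?_ ?_ ?_
  · intro h0
    have : w ∈ LinearMap.range j := by rw [← hrk]; exact h0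
    obtain ⟨m, hm⟩ := this
    apply hv0
    rw [← hwe, ← hm, ← j0, L0, map_zero]
  · intro n
    obtain ⟨x, rfl⟩ := hps n
    refine ⟨l (I.θ 0 x) / l v, ?_⟩
    have hx : x = (l (I.θ 0 x) / l v) • w + ((l x - l (I.θ 0 x) / l v * l w) / l v) • v := by
      apply hfinj
      rw [hf, hf]
      refine Prod.ext ?_ ?_
      · simp only [map_add, map_smul, hwe, hve, smul_zero, add_zero, smul_eq_mul]
        field_simp
      · simp only [map_add, map_smul, smul_eq_mul]
        field_simp
        ring
    conv_rhs => rw [hx, map_add, map_smul, map_smul, hpv, smul_zero, add_zero]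
  · rw [← p0, hwe, hpv]
  · rw [← p1, hws, map_smul]

theorem omega_zero_trivial {r : Bool} {K N : GSupMod k (Fin 1)} (hK : IsTrivial r K)
    (h : IsOmegaZero (QCat k) K N) : IsTrivial r N := by
  obtain ⟨Q, hQ, -, hd⟩ := h
  obtain ⟨φ, -, h0⟩ := (isDsum_iff _ _ _).1 hd
  obtain ⟨-, K0, -⟩ := (isTrivial_iff _ _).1 hK
  obtain ⟨b, hb, -⟩ := htpy_of_proj hQ
  have hQ0 : ∀ x, Q.θ 0 x = 0 := by
    intro x
    have h1 := h0 (φ.symm (0, x))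
    rw [K0, map_zero, LinearEquiv.apply_symm_apply] at h1
    exact (congrArg Prod.snd h1).symm
  have hQz : ∀ x : Q.carrier, x = 0 := by
    intro x
    rw [← hb x, hQ0, hQ0, map_zero, add_zero]
  obtain ⟨f, f0, f1⟩ := dsum_zero_right hd hQz
  exact isTrivial_congr f f0 f1 hK

theorem omega_pow_trivial {K : GSupMod k (Fin 1)} (hK : IsTrivial false K) (n : ℕ) :
    ∀ N, IsOmegaPow (QCat k) n K N → IsTrivial (Nat.bodd n) N := by
  induction n with
  | zero => intro N h; exact omega_zero_trivial hK h
  | succ n ih =>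
    rintro N ⟨L, hL, hN⟩
    rw [Nat.bodd_succ]
    exact syzygy_trivial (ih L hL) hN

theorem omega_negpow_trivial {K : GSupMod k (Fin 1)} (hK : IsTrivial false K) (n : ℕ) :
    ∀ N, IsOmegaNegPow (QCat k) n K N → IsTrivial (Nat.bodd n) N := by
  induction n with
  | zero => intro N h; exact omega_zero_trivial hK h
  | succ n ih =>
    rintro N ⟨L, hL, hN⟩
    rw [Nat.bodd_succ]
    exact cosyzygy_trivial (ih L hL) hN

theorem bodd_even {n : ℕ} (h : Even n) : Nat.bodd n = false := by
  obtain ⟨m, rfl⟩ := h; simp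

theorem bodd_odd {n : ℕ} (h : ¬ Even n) : Nat.bodd n = true := by
  obtain ⟨m, rfl⟩ := Nat.not_even_iff_odd.1 h; simp; left; rfl

theorem part_two (n : ℤ) (K N : GSupMod k (Fin 1)) (hK : IsTrivial false K)
    (h : IsOmega (QCat k) n K N) :
    (Even n → IsTrivial false N) ∧ (¬ Even n → IsTrivial true N) := by
  unfold IsOmega at h
  split_ifs at h with hn
  · obtain ⟨m, rfl⟩ := Int.eq_ofNat_of_zero_le hn
    have := omega_pow_trivial hK _ N h
    rw [Int.toNat_natCast] at this
    rw [Int.even_coe_nat]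
    exact ⟨fun he => bodd_even he ▸ this, fun he => bodd_odd he ▸ this⟩
  · obtain ⟨m, hm⟩ := Int.eq_ofNat_of_zero_le (show 0 ≤ -n by omega)
    have := omega_negpow_trivial hK _ N h
    rw [hm, Int.toNat_natCast] at this
    rw [← even_neg, hm, Int.even_coe_nat]
    exact ⟨fun he => bodd_even he ▸ this, fun he => bodd_odd he ▸ this⟩

end omega

end SupCat

namespace SupCat

section group

open GSupMod

set_option linter.unusedSectionVars false

variable {k : Type} [Field k] [CharZero k]

/-- the superdimension, as an element of the ground field -/
def sdim (M : GSupMod k (Fin 1)) : k := LinearMap.trace k M.carrier M.sigma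

theorem trace_congr {V W : Type} [AddCommGroup V] [Module k V] [AddCommGroup W] [Module k W]
    (f : V ≃ₗ[k] W) (s : V →ₗ[k] V) (t : W →ₗ[k] W) (h : ∀ x, f (s x) = t (f x)) :
    LinearMap.trace k V s = LinearMap.trace k W t := by
  rw [← LinearMap.trace_conj' s f]
  congr 1
  ext x
  rw [LinearEquiv.conj_apply_apply, h, LinearEquiv.apply_symm_apply]

theorem sdim_iso {M N : GSupMod k (Fin 1)} (h : Iso M N) : sdim M = sdim N := by
  obtain ⟨f, hf⟩ := h
  exact trace_congr f _ _ ((isHom_iff _ _ _).1 hf).2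

theorem sdim_dsum {A B S : GSupMod k (Fin 1)} (h : IsDsum A B S) :
    sdim S = sdim A + sdim B := by
  obtain ⟨φ, h1, -⟩ := (isDsum_iff _ _ _).1 h
  unfold sdim
  rw [trace_congr φ S.sigma (LinearMap.prodMap A.sigma B.sigma) h1, LinearMap.trace_prodMap']

theorem sdim_proj {P : GSupMod k (Fin 1)} (h : IsProjective (QCat k) P) : sdim P = 0 := by
  obtain ⟨b, hb, hbs⟩ := htpy_of_proj h
  have h1 : P.sigma = (P.sigma * b) * P.θ 0 - P.θ 0 * (P.sigma * b) := by
    ext x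
    simp only [Module.End.mul_apply, LinearMap.sub_apply]
    conv_lhs => rw [← hb x]
    rw [map_add, sigma_theta, ← neg_eq_iff_eq_neg.2 (sigma_theta P 0 (b x)), sigma_theta]
    abel
  unfold sdim
  rw [h1, map_sub, LinearMap.trace_mul_comm, sub_self]

theorem sdim_trivial {r : Bool} {C : GSupMod k (Fin 1)} (h : IsTrivial r C) :
    sdim C = sg k r := by
  obtain ⟨h1, -, h2⟩ := (isTrivial_iff _ _).1 h
  have h3 : C.sigma = sg k r • LinearMap.id := by ext x; simp [h2]
  unfold sdim
  rw [h3, map_smul, LinearMap.trace_id, h1]; simp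

theorem sdim_endo {M : GSupMod k (Fin 1)} (h : IsEndotrivial (QCat k) M) :
    ∃ r, sdim M = sg k r := by
  obtain ⟨r, C, P, hC, hP, hd⟩ := endo_struct h
  exact ⟨r, by rw [sdim_dsum hd, sdim_trivial hC, sdim_proj hP, add_zero]⟩

theorem sdim_stIso {M N : GSupMod k (Fin 1)} (h : StIso (QCat k) M N) : sdim M = sdim N := by
  obtain ⟨P, Q, S, T, hP, hQ, h1, h2, h3⟩ := h
  have := sdim_iso h3
  rwa [sdim_dsum h1, sdim_dsum h2, sdim_proj hP, sdim_proj hQ, add_zero, add_zero] at this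

theorem sdim_tensor {M N T : GSupMod k (Fin 1)} (h : IsTensorObj M N T) :
    sdim T = sdim M * sdim N := by
  obtain ⟨φ, h0, h1, -⟩ := h
  unfold sdim
  rw [← LinearMap.trace_tensorProduct' M.sigma N.sigma]
  refine trace_congr φ _ _ ?_
  refine lin_ext T (f := φ.toLinearMap ∘ₗ T.sigma)
    (g := TensorProduct.map M.sigma N.sigma ∘ₗ φ.toLinearMap) ?_ ?_
  · intro x hx
    have hz : φ x ∈ LinearMap.ker (TensorProduct.map M.sigma N.sigma - LinearMap.id) := by
      have h2 : φ x ∈ Submodule.map φ.toLinearMap T.ev := ⟨x, hx, rfl⟩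
      rw [h0] at h2
      refine Submodule.span_le.2 ?_ h2
      rintro z (⟨m, hm, n, hn, rfl⟩ | ⟨m, hm, n, hn, rfl⟩)
      · simp [sigma_of_ev _ hm, sigma_of_ev _ hn]
      · simp [sigma_of_od _ hm, sigma_of_od _ hn, TensorProduct.tmul_neg, TensorProduct.neg_tmul]
    rw [LinearMap.mem_ker, LinearMap.sub_apply, sub_eq_zero] at hz
    simp only [LinearMap.comp_apply, LinearEquiv.coe_coe]
    rw [hz, sigma_of_ev _ hx]; rfl
  · intro x hx
    have hz : φ x ∈ LinearMap.ker (TensorProduct.map M.sigma N.sigma + LinearMap.id) := by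
      have h2 : φ x ∈ Submodule.map φ.toLinearMap T.od := ⟨x, hx, rfl⟩
      rw [h1] at h2
      refine Submodule.span_le.2 ?_ h2
      rintro z (⟨m, hm, n, hn, rfl⟩ | ⟨m, hm, n, hn, rfl⟩)
      · simp [sigma_of_ev _ hm, sigma_of_od _ hn, TensorProduct.tmul_neg]
      · simp [sigma_of_od _ hm, sigma_of_ev _ hn, TensorProduct.neg_tmul]
    rw [LinearMap.mem_ker, LinearMap.add_apply, add_eq_zero_iff_eq_neg] at hz
    simp only [LinearMap.comp_apply, LinearEquiv.coe_coe]
    rw [hz, sigma_of_od _ hx, map_neg]; rfl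

theorem sdim_dual {M D : GSupMod k (Fin 1)} (h : IsDualObj M D) : sdim D = sdim M := by
  obtain ⟨φ, h0, h1, -⟩ := h
  unfold sdim
  rw [← LinearMap.trace_transpose' M.sigma]
  refine trace_congr φ _ _ ?_
  refine lin_ext D (f := φ.toLinearMap ∘ₗ D.sigma)
    (g := Module.Dual.transpose M.sigma ∘ₗ φ.toLinearMap) ?_ ?_
  · intro x hx
    have hz := (h0 x).1 hx
    refine LinearMap.ext (lin_ext M ?_ ?_)
    · intro m hm
      simp [sigma_of_ev _ hx, Module.Dual.transpose_apply, sigma_of_ev _ hm]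
    · intro m hm
      simp [sigma_of_ev _ hx, Module.Dual.transpose_apply, sigma_of_od _ hm, hz m hm]
  · intro x hx
    have hz := (h1 x).1 hx
    refine LinearMap.ext (lin_ext M ?_ ?_)
    · intro m hm
      simp [sigma_of_od _ hx, Module.Dual.transpose_apply, sigma_of_ev _ hm, hz m hm]
    · intro m hm
      simp [sigma_of_od _ hx, Module.Dual.transpose_apply, sigma_of_od _ hm]

/-- the direct sum of two modules -/
def dsumS (A B : GSupMod k (Fin 1)) : GSupMod k (Fin 1) :=
  mkS (A.carrier × B.carrier) (LinearMap.prodMap A.sigma B.sigma)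
    (LinearMap.prodMap (A.θ 0) (B.θ 0))
    (by intro x; ext <;> simp [sigma_sigma])
    (by intro x; ext <;> simp [sigma_theta])

theorem dsumS_sigma (A B : GSupMod k (Fin 1)) (x : A.carrier × B.carrier) :
    ((dsumS A B).sigma x : A.carrier × B.carrier) = (A.sigma x.1, B.sigma x.2) :=
  mkS_sigma (A.carrier × B.carrier) _ _ _ _ x

theorem isDsum_dsumS (A B : GSupMod k (Fin 1)) : IsDsum A B (dsumS A B) := by
  refine (isDsum_iff _ _ _).2
    ⟨(LinearEquiv.refl k (A.carrier × B.carrier)), fun s => ?_, fun s => ?_⟩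
  · exact dsumS_sigma A B s
  · rfl

theorem sg_inj {r s : Bool} (h : sg k r = sg k s) : r = s := by
  have h2 : (1 : k) ≠ -1 := fun h => by
    have := eq_zero_of_eq_neg (k := k) h
    exact one_ne_zero this
  cases r <;> cases s <;> simp [sg] at h ⊢
  · exact h2 h
  · exact h2 h.symm

theorem stIso_of_sdim {M N : GSupMod k (Fin 1)} (hM : IsEndotrivial (QCat k) M)
    (hN : IsEndotrivial (QCat k) N) (h : sdim M = sdim N) : StIso (QCat k) M N := by
  obtain ⟨r, C, P, hC, hP, hd⟩ := endo_struct hM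
  obtain ⟨r', C', P', hC', hP', hd'⟩ := endo_struct hN
  rw [sdim_dsum hd, sdim_dsum hd', sdim_proj hP, sdim_proj hP', add_zero, add_zero,
    sdim_trivial hC, sdim_trivial hC'] at h
  obtain rfl := sg_inj h
  obtain ⟨c0, c1, c2⟩ := (isTrivial_iff _ _).1 hC
  obtain ⟨d0, d1, d2⟩ := (isTrivial_iff _ _).1 hC'
  obtain ⟨f, f1, f0⟩ := (isDsum_iff _ _ _).1 hd
  obtain ⟨g, g1, g0⟩ := (isDsum_iff _ _ _).1 hd'
  let c : C.carrier ≃ₗ[k] C'.carrier := LinearEquiv.ofFinrankEq _ _ (c0.trans d0.symm)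
  refine ⟨P', P, dsumS M P', dsumS N P, hP', hP, isDsum_dsumS _ _, isDsum_dsumS _ _, ?_⟩
  let F : (M.carrier × P'.carrier) →ₗ[k] (N.carrier × P.carrier) :=
    LinearMap.prod
      (g.symm.toLinearMap ∘ₗ LinearMap.prod
        (c.toLinearMap ∘ₗ LinearMap.fst _ _ _ ∘ₗ f.toLinearMap ∘ₗ LinearMap.fst _ _ _)
        (LinearMap.snd _ _ _))
      (LinearMap.snd _ _ _ ∘ₗ f.toLinearMap ∘ₗ LinearMap.fst _ _ _)
  let F' : (N.carrier × P.carrier) →ₗ[k] (M.carrier × P'.carrier) :=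
    LinearMap.prod
      (f.symm.toLinearMap ∘ₗ LinearMap.prod
        (c.symm.toLinearMap ∘ₗ LinearMap.fst _ _ _ ∘ₗ g.toLinearMap ∘ₗ LinearMap.fst _ _ _)
        (LinearMap.snd _ _ _))
      (LinearMap.snd _ _ _ ∘ₗ g.toLinearMap ∘ₗ LinearMap.fst _ _ _)
  have hF : ∀ x, F x = (g.symm (c (f x.1).1, x.2), (f x.1).2) := fun _ => rfl
  have hF' : ∀ x, F' x = (f.symm (c.symm (g x.1).1, x.2), (g x.1).2) := fun _ => rfl
  let E : (M.carrier × P'.carrier) ≃ₗ[k] (N.carrier × P.carrier) :=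
    LinearEquiv.ofLinearMap F F'
      (LinearMap.ext fun x => by
        simp only [LinearMap.comp_apply, LinearMap.id_apply]
        rw [hF, hF']; simp)
      (LinearMap.ext fun x => by
        simp only [LinearMap.comp_apply, LinearMap.id_apply]
        rw [hF', hF]; simp)
  have key0 : ∀ x : M.carrier × P'.carrier,
      F (M.θ 0 x.1, P'.θ 0 x.2) = (N.θ 0 (F x).1, P.θ 0 (F x).2) := by
    intro x
    rw [hF, hF, f0]
    refine Prod.ext ?_ rfl
    apply g.injective
    simp only [g0, LinearEquiv.apply_symm_apply, c1, d1, map_zero]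
  have key1 : ∀ x : M.carrier × P'.carrier,
      F (M.sigma x.1, P'.sigma x.2) = (N.sigma (F x).1, P.sigma (F x).2) := by
    intro x
    rw [hF, hF, f1]
    refine Prod.ext ?_ rfl
    apply g.injective
    simp only [g1, LinearEquiv.apply_symm_apply, c2, d2, map_smul]
  refine ⟨E, (isHom_iff _ _ _).2 ⟨fun x => key0 x, fun x => ?_⟩⟩
  exact (congrArg F (dsumS_sigma _ _ x)).trans ((key1 x).trans (dsumS_sigma _ _ (F x)).symm)

/-- the one-dimensional trivial modules -/
def triv (k : Type) [Field k] [CharZero k] (r : Bool) : GSupMod k (Fin 1) :=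
  mkS k (sg k r • LinearMap.id) 0
    (by intro x; simp [← mul_assoc, sg_mul_self])
    (by intro x; simp)

theorem triv_sigma (r : Bool) (x : k) : ((triv k r).sigma x : k) = sg k r * x :=
  mkS_sigma k _ _ _ _ x

theorem triv_isTrivial (r : Bool) : IsTrivial r (triv k r) :=
  (isTrivial_iff _ _).2 ⟨Module.finrank_self k, fun _ => rfl, triv_sigma (k := k) r⟩

/-- the zero module -/
def zeroS (k : Type) [Field k] [CharZero k] : GSupMod k (Fin 1) :=
  mkS PUnit 0 0 (fun _ => rfl) (fun _ => rfl)

theorem zeroS_proj : IsProjective (QCat k) (zeroS k) := by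
  refine proj_of_htpy (qcat_of_sq_zero fun _ => rfl) ⟨0, fun _ => rfl, fun _ => rfl⟩

theorem homObj_triv {r : Bool} {M H : GSupMod k (Fin 1)} (hM : IsTrivial r M)
    (hH : IsTrivial false H) : IsHomObj M M H := by
  obtain ⟨m0, m1, m2⟩ := (isTrivial_iff _ _).1 hM
  obtain ⟨h0, h1, h2⟩ := (isTrivial_iff _ _).1 hH
  have hd : Module.finrank k H.carrier = Module.finrank k (M.carrier →ₗ[k] M.carrier) := by
    rw [Module.finrank_linearMap, m0, h0]
  have hs : ∀ x, H.sigma x = x := fun x => by rw [h2]; simp [sg]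
  have hcomm : ∀ (f : M.carrier →ₗ[k] M.carrier) x, f (M.sigma x) = M.sigma (f x) := fun f x => by
    rw [m2, m2, map_smul]
  have hfe : ∀ (f : M.carrier →ₗ[k] M.carrier), ∀ x ∈ M.ev, f x ∈ M.ev := fun f x hx => by
    rw [mem_ev_iff] at hx ⊢
    rw [← hcomm, hx]
  have hfo : ∀ (f : M.carrier →ₗ[k] M.carrier), ∀ x ∈ M.od, f x ∈ M.od := fun f x hx => by
    rw [mem_od_iff] at hx ⊢
    rw [← hcomm, hx, map_neg]
  have hdis := Submodule.disjoint_def.1 M.isCompl.disjoint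
  refine ⟨LinearEquiv.ofFinrankEq _ _ hd, ?_, ?_, ?_⟩
  · intro h
    exact iff_of_true ((mem_ev_iff _).2 (hs h)) ⟨hfe _, hfo _⟩
  · intro h
    constructor
    · intro hh
      have : h = 0 := eq_zero_of_eq_neg (k := k) ((hs h).symm.trans (sigma_of_od _ hh))
      rw [this, map_zero]
      exact ⟨fun _ _ => Submodule.zero_mem _, fun _ _ => Submodule.zero_mem _⟩
    · rintro ⟨a, b⟩
      have : LinearEquiv.ofFinrankEq _ _ hd h = 0 :=
        LinearMap.ext (lin_ext M (fun x hx => hdis _ (hfe _ x hx) (a x hx))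
          (fun x hx => hdis _ (b x hx) (hfo _ x hx)))
      rw [LinearEquiv.map_eq_zero_iff] at this
      rw [this]
      exact Submodule.zero_mem _
  · intro i h
    have hi : i = 0 := Subsingleton.elim _ _
    subst hi
    refine LinearMap.ext fun x => ?_
    simp [m1, h1]

theorem triv_endo (r : Bool) : IsEndotrivial (QCat k) (triv k r) := by
  refine ⟨qcat_of_sq_zero fun _ => rfl, triv k false, triv k false, zeroS k,
    dsumS (triv k false) (zeroS k), ?_, qcat_of_sq_zero fun _ => rfl, triv_isTrivial _,
    zeroS_proj, isDsum_dsumS _ _, ?_⟩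
  · exact homObj_triv (triv_isTrivial r) (triv_isTrivial false)
  · let f : k ≃ₗ[k] (k × PUnit) :=
      LinearEquiv.ofLinearMap (LinearMap.prod LinearMap.id 0) (LinearMap.fst k k PUnit)
        (LinearMap.ext fun x => rfl) (LinearMap.ext fun x => rfl)
    refine ⟨f, (isHom_iff _ _ _).2 ⟨fun x => rfl, fun x => ?_⟩⟩
    refine Eq.trans ?_ (dsumS_sigma (triv k false) (zeroS k) (f x)).symm
    rfl

open Classical in
/-- the isomorphism of `T` with the group of order two -/
def phi (k : Type) [Field k] [CharZero k] : TGrp (QCat k) → ZMod 2 :=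
  Quot.lift (fun M => if sdim M.1 = 1 then 0 else 1)
    (fun M N h => by
      have h1 : sdim M.1 = sdim N.1 := sdim_stIso h
      simp only [h1])

theorem phi_tmk {r : Bool} (M : {M : GSupMod k (Fin 1) // IsEndotrivial (QCat k) M})
    (h : sdim M.1 = sg k r) : phi k (tmk (QCat k) M) = if r then 1 else 0 := by
  classical
  change (if sdim M.1 = 1 then (0 : ZMod 2) else 1) = _
  rw [h]
  cases r
  · simp [sg]
  · rw [if_neg (fun h => by
      have : sg k true = sg k false := h.trans (by simp [sg])
      exact absurd (sg_inj this) (by decide))]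
    simp

theorem phi_bij : Function.Bijective (phi k) := by
  constructor
  · rintro ⟨M⟩ ⟨N⟩ h
    obtain ⟨r, hr⟩ := sdim_endo M.2
    obtain ⟨s, hs⟩ := sdim_endo N.2
    change phi k (tmk _ M) = phi k (tmk _ N) at h
    rw [phi_tmk M hr, phi_tmk N hs] at h
    have hrs : r = s := by
      clear hr hs
      revert r s
      decide
    exact Quot.sound (stIso_of_sdim M.2 N.2 (by rw [hr, hs, hrs]))
  · have h : ∀ r : Bool, phi k (tmk (QCat k) ⟨triv k r, triv_endo r⟩) = if r then 1 else 0 :=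
      fun r => phi_tmk _ (sdim_trivial (triv_isTrivial r))
    intro z
    fin_cases z
    · exact ⟨_, h false⟩
    · exact ⟨_, h true⟩

theorem sg_xor (r s : Bool) : sg k r * sg k s = sg k (xor r s) := by
  cases r <;> cases s <;> simp [sg]

/-- the group structure on `T` -/
def tdata (k : Type) [Field k] [CharZero k] : TGroupData (QCat k) :=
  let e := Equiv.ofBijective (phi k) phi_bij
  have he : ∀ x, e x = phi k x := fun _ => rfl
  { mul := fun x y => e.symm (e x + e y)
    one := e.symm 0
    inv := fun x => e.symm (- e x)
    mul_assoc := fun a b c => by simp [add_assoc]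
    mul_comm := fun a b => by rw [add_comm]
    one_mul := fun a => by simp
    inv_mul := fun a => by rw [e.apply_symm_apply, neg_add_cancel]
    mul_spec := fun M N T h hT => by
      obtain ⟨r, hr⟩ := sdim_endo M.2
      obtain ⟨s, hs⟩ := sdim_endo N.2
      rw [Equiv.symm_apply_eq, he, he, he, phi_tmk M hr, phi_tmk N hs,
        phi_tmk (r := xor r s) ⟨T, hT⟩ ((sdim_tensor h).trans (by rw [hr, hs, sg_xor]))]
      cases r <;> cases s <;> decide
    one_spec := fun K h hK => by
      rw [Equiv.symm_apply_eq, he, phi_tmk ⟨K, hK⟩ (sdim_trivial h)]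
      simp
    inv_spec := fun M D h hD => by
      obtain ⟨r, hr⟩ := sdim_endo M.2
      rw [Equiv.symm_apply_eq, he, he, phi_tmk M hr,
        phi_tmk ⟨D, hD⟩ ((sdim_dual h).trans hr)]
      cases r <;> decide }

theorem phi_mul (x y : TGrp (QCat k)) : phi k ((tdata k).mul x y) = phi k x + phi k y :=
  (Equiv.ofBijective (phi k) phi_bij).apply_symm_apply _

end group

end SupCat


open SupCat SupCat.GSupMod in
/-- Let `e₁ = q(1)` be the rank one detecting subalgebra of
type `e`.  Then the group of endotrivial modules `T(e₁)` is isomorphic to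
`ℤ/2ℤ`; explicitly, the only indecomposable endotrivial `e₁`-supermodules are
`k_ev` and `k_od`, and `Ωⁿ(k_ev) = k_ev` for `n` even and `k_od` for `n` odd.
(The group structure on the stable classes is induced by the tensor product,
and the isomorphism sends the class of `k_od` to `1 ∈ ℤ/2ℤ`.) -/
theorem T_of_q1_is_Z2
    (k : Type) [Field k] [IsAlgClosed k] [CharZero k] :
    (∀ M : GSupMod k (Fin 1), Indecomposable M →
      IsEndotrivial (QCat k) M → ∃ p : Bool, IsTrivial p M) ∧
    (∀ (n : ℤ) (K N : GSupMod k (Fin 1)), QCat k K → IsTrivial false K →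
      IsOmega (QCat k) n K N →
        (Even n → IsTrivial false N) ∧ (¬ Even n → IsTrivial true N)) ∧
    ∃ (G : TGroupData (QCat k)) (φ : TGrp (QCat k) → ZMod 2),
      Function.Bijective φ ∧
      (∀ x y, φ (G.mul x y) = φ x + φ y) ∧
      (∀ (K : GSupMod k (Fin 1)) (_ : IsTrivial true K)
         (hE : IsEndotrivial (QCat k) K),
         φ (tmk (QCat k) ⟨K, hE⟩) = 1) := by
  refine ⟨fun M hi h => part_one hi h, fun n K N _ hK h => part_two n K N hK h,
    tdata k, phi k, phi_bij, phi_mul, ?_⟩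
  intro K hK hE
  rw [phi_tmk ⟨K, hE⟩ (sdim_trivial hK)]
  simp
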